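/- For every two-matroid median instance and every fractional solution (x,y), there exists an integral solution whose cost is at most 8 times the cost of (x,y). -/

import Mathlib

open scoped Classical
open Finset

/-- The rank function of a matroid: the maximum cardinality of an independent
subset of the given set. -/
noncomputable def matroidRank {α : Type*} (M : Matroid α) (S : Finset α) : ℕ :=
  (S.powerset.filter (fun I : Finset α => M.Indep ↑I)).sup Finset.card



theorem tm_count {ι L : Type*} [Fintype ι] [Nonempty ι] (m1 m2 : ι → Option L)
    (h1 : ∀ e U, m1 e = some U → ∃ e', e' ≠ e ∧ m1 e' = some U)
    (h2 : ∀ e U, m2 e = some U → ∃ e', e' ≠ e ∧ m2 e' = some U) :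
    ∃ v : ι → ℝ, v ≠ 0 ∧ (∀ U, ∑ e with m1 e = some U, v e = 0) ∧
      (∀ U, ∑ e with m2 e = some U, v e = 0) := by
  set K1 : Finset (Option L) := (univ.image m1).erase none with hK1
  set K2 : Finset (Option L) := (univ.image m2).erase none with hK2
  let Λ : (ι → ℝ) →ₗ[ℝ] (K1 → ℝ) × (K2 → ℝ) :=
    { toFun := fun v => (fun U => ∑ e with m1 e = U, v e, fun U => ∑ e with m2 e = U, v e)
      map_add' := by intro a b; ext <;> simp [Finset.sum_add_distrib]
      map_smul' := by intro a b; ext <;> simp [Finset.mul_sum] }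
  have card2 : ∀ (m : ι → Option L),
      (∀ e U, m e = some U → ∃ e', e' ≠ e ∧ m e' = some U) →
      2 * #((univ.image m).erase none) ≤ #(univ.filter (fun e => m e ≠ none)) := by
    intro m hm
    have hmap : ∀ e ∈ univ.filter (fun e => m e ≠ none), m e ∈ (univ.image m).erase none := by
      intro e he; simp at he ⊢; exact he
    rw [Finset.card_eq_sum_card_fiberwise hmap, mul_comm, ← smul_eq_mul]
    apply Finset.card_nsmul_le_sum
    intro U hU
    obtain ⟨hU0, hU1⟩ := Finset.mem_erase.1 hU
    obtain ⟨e, -, he⟩ := Finset.mem_image.1 hU1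
    obtain ⟨U', rfl⟩ := Option.ne_none_iff_exists'.1 hU0
    obtain ⟨e', hne, he'⟩ := hm e U' he
    have : ({e', e} : Finset ι) ⊆ {a ∈ univ.filter (fun e => m e ≠ none) | m a = some U'} := by
      intro a ha
      simp at ha
      rcases ha with rfl | rfl <;> simp [*]
    calc 2 = #({e', e} : Finset ι) := (Finset.card_pair hne).symm
      _ ≤ _ := Finset.card_le_card this
  have c1 := card2 m1 h1
  have c2 := card2 m2 h2
  have d1 : #(univ.filter (fun e => m1 e ≠ none)) ≤ Fintype.card ι := Finset.card_le_univ _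
  have d2 : #(univ.filter (fun e => m2 e ≠ none)) ≤ Fintype.card ι := Finset.card_le_univ _
  have hninj : ¬ Function.Injective Λ := by
    intro hinj
    have hle := LinearMap.finrank_le_finrank_of_injective hinj
    have hf2 : Module.finrank ℝ ((K1 → ℝ) × (K2 → ℝ)) = #K1 + #K2 := by
      simp
    have hf1 : Module.finrank ℝ (ι → ℝ) = Fintype.card ι := by simp
    rw [hf1, hf2] at hle
    rw [← hK1] at c1
    rw [← hK2] at c2
    have hsurj : Function.Surjective Λ :=
      (LinearMap.injective_iff_surjective_of_finrank_eq_finrank (by rw [hf1, hf2]; omega)).1 hinj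
    have hpos : 0 < Fintype.card ι := Fintype.card_pos
    have a1 : univ.filter (fun e => m1 e ≠ none) = univ := by
      apply Finset.eq_univ_of_card; omega
    have a2 : univ.filter (fun e => m2 e ≠ none) = univ := by
      apply Finset.eq_univ_of_card; omega
    obtain ⟨v, hv⟩ := hsurj (fun _ => 1, fun _ => 0)
    have tot : ∀ (m : ι → Option L), univ.filter (fun e => m e ≠ none) = univ →
        ∑ U : ((univ.image m).erase none : Finset (Option L)), ∑ e with m e = (U : Option L), v e
          = ∑ e, v e := by
      intro m hm
      rw [Finset.sum_coe_sort ((univ.image m).erase none) (fun U => ∑ e with m e = U, v e)]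
      apply Finset.sum_fiberwise_of_maps_to
      intro e he
      rw [← hm] at he
      simp at he ⊢; exact he
    have t1 := tot m1 a1
    have t2 := tot m2 a2
    have v1 : ∀ U : K1, ∑ e with m1 e = (U : Option L), v e = 1 := fun U =>
      congrFun (congrArg Prod.fst hv) U
    have v2 : ∀ U : K2, ∑ e with m2 e = (U : Option L), v e = 0 := fun U =>
      congrFun (congrArg Prod.snd hv) U
    rw [Finset.sum_congr rfl (fun U _ => v1 U)] at t1
    rw [Finset.sum_congr rfl (fun U _ => v2 U)] at t2
    rw [← t2] at t1
    simp at t1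
    have : #K1 = 0 := by rw [hK1, t1]; rfl
    omega
  rw [← LinearMap.ker_eq_bot, Submodule.eq_bot_iff] at hninj
  push Not at hninj
  obtain ⟨v, hv, hv0⟩ := hninj
  have hv' : Λ v = 0 := hv
  have key : ∀ (m : ι → Option L),
      (∀ U : ((univ.image m).erase none : Finset (Option L)), ∑ e with m e = (U : Option L), v e = 0) →
      ∀ U, ∑ e with m e = some U, v e = 0 := by
    intro m h U
    by_cases hU : ∃ e, m e = some U
    · exact h ⟨some U, by simpa using hU⟩
    · push Not at hU
      rw [Finset.filter_false_of_mem (fun e _ => hU e)]; simp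
  exact ⟨v, hv0, key m1 fun U => congrFun (congrArg Prod.fst hv') U,
    key m2 fun U => congrFun (congrArg Prod.snd hv') U⟩

/-- The integers inside the reals. -/
def tmInt : AddSubgroup ℝ := (Int.castAddHom ℝ).range

theorem tm_mem_int {a : ℝ} : a ∈ tmInt ↔ ∃ n : ℤ, (n : ℝ) = a := by
  unfold tmInt
  rw [AddMonoidHom.mem_range]
  rfl

theorem tm_partition {E : Type*} [Fintype E] (T : Set (Finset E))
    (hT : ∀ U ∈ T, ∀ V ∈ T, (U ∩ V).Nonempty → U ∩ V ∈ T)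
    (z : E → ℝ) (hz : ∀ U ∈ T, ∑ e ∈ U, z e ∈ tmInt) :
    ∃ m : E → Option (Finset E), (∀ U, ∑ e with m e = some U, z e ∈ tmInt) ∧
      ∀ v : E → ℝ, (∀ U, ∑ e with m e = some U, v e = 0) → ∀ U ∈ T, ∑ e ∈ U, v e = 0 := by
  have hmin : ∀ e, (∃ U ∈ T, e ∈ U) → ∃ U ∈ T, e ∈ U ∧ ∀ V ∈ T, e ∈ V → U ⊆ V := by
    intro e ⟨U0, hU0, he0⟩
    obtain ⟨U, ⟨hU, he⟩, hUm⟩ := Set.exists_min_image {U | U ∈ T ∧ e ∈ U} Finset.card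
      (Set.toFinite _) ⟨U0, hU0, he0⟩
    refine ⟨U, hU, he, fun V hV heV => ?_⟩
    have h1 := hT U hU V hV ⟨e, by simp [he, heV]⟩
    have h2 := hUm (U ∩ V) ⟨h1, by simp [he, heV]⟩
    have h3 := Finset.eq_of_subset_of_card_le Finset.inter_subset_left h2
    rw [← h3]; exact Finset.inter_subset_right
  choose! M hM1 hM2 hM3 using hmin
  let m : E → Option (Finset E) := fun e => if ∃ U ∈ T, e ∈ U then some (M e) else none
  have hm : ∀ e U, m e = some U → U ∈ T ∧ e ∈ U ∧ ∀ V ∈ T, e ∈ V → U ⊆ V := by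
    intro e U h
    by_cases hc : ∃ U ∈ T, e ∈ U
    · have : m e = some (M e) := if_pos hc
      rw [this] at h
      cases h
      exact ⟨hM1 e hc, hM2 e hc, hM3 e hc⟩
    · have : m e = none := if_neg hc
      rw [this] at h; cases h
  have hm' : ∀ e U, U ∈ T → e ∈ U → m e = some (M e) := fun e U h1 h2 => if_pos ⟨U, h1, h2⟩
  have hsum : ∀ v : E → ℝ, ∀ U ∈ T,
      ∑ e ∈ U, v e = ∑ V ∈ U.powerset, ∑ e with m e = some V, v e := by
    intro v U hU
    have hmaps : ∀ e ∈ U, M e ∈ U.powerset := by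
      intro e he
      exact Finset.mem_powerset.2 (hM3 e ⟨U, hU, he⟩ U hU he)
    rw [← Finset.sum_fiberwise_of_maps_to hmaps]
    apply Finset.sum_congr rfl
    intro V hV
    apply Finset.sum_congr _ (fun _ _ => rfl)
    ext e
    simp only [Finset.mem_filter, Finset.mem_univ, true_and]
    constructor
    · rintro ⟨h1, h2⟩
      rw [hm' e U hU h1, h2]
    · intro h
      have h2 := (hm e V h)
      have h3 := Finset.mem_powerset.1 hV h2.2.1
      rw [hm' e U hU h3] at h
      exact ⟨h3, by simpa using h⟩
  refine ⟨m, ?_, ?_⟩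
  · intro U
    induction U using Finset.strongInduction with
    | H U ih =>
      by_cases hU : U ∈ T
      · have h1 := hsum z U hU
        rw [← Finset.add_sum_erase _ _ (Finset.mem_powerset_self U)] at h1
        have h2 : ∑ V ∈ U.powerset.erase U, ∑ e with m e = some V, z e ∈ tmInt := by
          apply sum_mem
          intro V hV
          rw [Finset.mem_erase, Finset.mem_powerset] at hV
          exact ih V (Finset.ssubset_iff_subset_ne.2 ⟨hV.2, hV.1⟩)
        have h3 := sub_mem (hz U hU) h2
        rw [h1] at h3
        simpa using h3
      · rw [Finset.filter_false_of_mem]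
        · simp [tmInt.zero_mem]
        · intro e _ h
          exact hU (hm e U h).1
  · intro v hv U hU
    rw [hsum v U hU]
    exact Finset.sum_eq_zero fun V _ => hv V

theorem tm_dir {E : Type*} [Fintype E] (T1 T2 : Set (Finset E))
    (hT1 : ∀ U ∈ T1, ∀ V ∈ T1, (U ∩ V).Nonempty → U ∩ V ∈ T1)
    (hT2 : ∀ U ∈ T2, ∀ V ∈ T2, (U ∩ V).Nonempty → U ∩ V ∈ T2)
    (z : E → ℝ) (hz1 : ∀ U ∈ T1, ∑ e ∈ U, z e ∈ tmInt) (hz2 : ∀ U ∈ T2, ∑ e ∈ U, z e ∈ tmInt)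
    (hfr : ∃ e, z e ∉ tmInt) :
    ∃ v : E → ℝ, v ≠ 0 ∧ (∀ e, z e ∈ tmInt → v e = 0) ∧ (∀ U ∈ T1, ∑ e ∈ U, v e = 0) ∧
      (∀ U ∈ T2, ∑ e ∈ U, v e = 0) := by
  obtain ⟨m1, hm1, hp1⟩ := tm_partition T1 hT1 z hz1
  obtain ⟨m2, hm2, hp2⟩ := tm_partition T2 hT2 z hz2
  let ι := {e // z e ∉ tmInt}
  have : Nonempty ι := ⟨⟨hfr.choose, hfr.choose_spec⟩⟩
  have two : ∀ m : E → Option (Finset E), (∀ U, ∑ e with m e = some U, z e ∈ tmInt) →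
      ∀ (e : ι) U, m e = some U → ∃ e' : ι, e' ≠ e ∧ m e' = some U := by
    intro m hm e U he
    by_contra hcon
    push Not at hcon
    apply e.2
    have h1 := hm U
    rw [← Finset.add_sum_erase _ _ (show e.1 ∈ univ.filter (fun e => m e = some U) by simpa using he)] at h1
    have h2 : ∑ x ∈ (univ.filter (fun e => m e = some U)).erase e.1, z x ∈ tmInt := by
      apply sum_mem
      intro x hx
      simp at hx
      by_contra hxx
      exact hcon ⟨x, hxx⟩ (fun h => hx.1 (congrArg Subtype.val h)) hx.2
    simpa using sub_mem h1 h2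
  obtain ⟨v, hv0, hv1, hv2⟩ := tm_count (fun e : ι => m1 e) (fun e : ι => m2 e)
    (two m1 hm1) (two m2 hm2)
  let w : E → ℝ := fun e => if h : z e ∉ tmInt then v ⟨e, h⟩ else 0
  have hw : ∀ e : ι, w e = v e := fun e => dif_pos e.2
  have hw0 : ∀ e, z e ∈ tmInt → w e = 0 := fun e he => dif_neg (by simpa using he)
  have hs : ∀ m : E → Option (Finset E), ∀ U, ∑ e with m e = some U, w e
      = ∑ e ∈ (univ : Finset ι).filter (fun e : ι => m e.1 = some U), v e := by
    intro m U
    rw [Finset.sum_filter, Finset.sum_filter]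
    have h1 : ∑ e : ι, (if m e.1 = some U then v e else 0)
        = ∑ e : ι, (fun e : E => if m e = some U then w e else 0) e.1 :=
      Finset.sum_congr rfl fun e _ => by simp only [hw e]
    rw [h1, ← Finset.sum_subtype (univ.filter (fun e => z e ∉ tmInt)) (by simp)
      (fun e : E => if m e = some U then w e else 0)]
    symm
    apply Finset.sum_subset (Finset.subset_univ _)
    intro e _ he
    have : w e = 0 := hw0 e (by simpa using he)
    simp [this]
  refine ⟨w, ?_, hw0, hp1 w fun U => ?_, hp2 w fun U => ?_⟩
  rotate_left
  · rw [hs m1 U]; convert hv1 U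
  · rw [hs m2 U]; convert hv2 U
  intro h
  apply hv0
  ext e
  rw [← hw e, h]; rfl

theorem tm_extreme {E K : Type*} [Fintype E] [Fintype K] (S : K → Finset E) (l u : K → ℤ)
    (tag : K → Bool) (B : ℝ) (P : Set (E → ℝ))
    (hP : P = {z : E → ℝ | (∀ e, 0 ≤ z e) ∧ ∀ k, (l k : ℝ) ≤ ∑ e ∈ S k, z e ∧
      ∑ e ∈ S k, z e ≤ (u k : ℝ)})
    (hB : ∀ z ∈ P, ∀ e, z e ≤ B)
    (hclos : ∀ z ∈ P, ∀ b, ∀ k k', tag k = b → tag k' = b →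
      ((l k : ℝ) = ∑ e ∈ S k, z e ∨ ∑ e ∈ S k, z e = u k) →
      ((l k' : ℝ) = ∑ e ∈ S k', z e ∨ ∑ e ∈ S k', z e = u k') →
      (S k ∩ S k').Nonempty →
      ∃ k'', tag k'' = b ∧ S k'' = S k ∩ S k' ∧
        ((l k'' : ℝ) = ∑ e ∈ S k'', z e ∨ ∑ e ∈ S k'', z e = u k''))
    (w : E → ℝ) (y : E → ℝ) (hy : y ∈ P) :
    ∃ z : E → ℤ, (fun e => (z e : ℝ)) ∈ P ∧ ∑ e, w e * z e ≤ ∑ e, w e * y e := by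
  have hclosed : IsClosed P := by
    rw [hP]
    have : {z : E → ℝ | (∀ e, 0 ≤ z e) ∧ ∀ k, (l k : ℝ) ≤ ∑ e ∈ S k, z e ∧ ∑ e ∈ S k, z e ≤ u k}
      = (⋂ e, {z : E → ℝ | 0 ≤ z e}) ∩
        ⋂ k, ({z : E → ℝ | (l k : ℝ) ≤ ∑ e ∈ S k, z e} ∩ {z : E → ℝ | ∑ e ∈ S k, z e ≤ u k}) := by
      ext z; simp
    rw [this]
    refine IsClosed.inter (isClosed_iInter fun e => ?_) (isClosed_iInter fun k => IsClosed.inter ?_ ?_)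
    · exact isClosed_le continuous_const (continuous_apply e)
    · exact isClosed_le continuous_const (by fun_prop)
    · exact isClosed_le (by fun_prop) continuous_const
  have hcomp : IsCompact P := by
    apply (isCompact_univ_pi (s := fun _ : E => Set.Icc (0 : ℝ) B) fun _ => isCompact_Icc).of_isClosed_subset hclosed
    intro z hz e _
    refine ⟨?_, hB z hz e⟩
    rw [hP] at hz
    exact hz.1 e
  let φ : StrongDual ℝ (E → ℝ) := -∑ e, w e • ContinuousLinearMap.proj (R := ℝ) (φ := fun _ : E => ℝ) e
  have hφ : ∀ z, φ z = -∑ e, w e * z e := by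
    intro z; simp [φ]
  have hexp : IsExposed ℝ P (φ.toExposed P) := ContinuousLinearMap.toExposed.isExposed
  obtain ⟨z0, hz0, hz0m⟩ := hcomp.exists_isMaxOn ⟨y, hy⟩ φ.continuous.continuousOn
  obtain ⟨z, hz⟩ := (hexp.isCompact hcomp).extremePoints_nonempty ⟨z0, hz0, fun a ha => hz0m ha⟩
  have hzP : z ∈ P := hz.1.1
  have hzy : φ y ≤ φ z := hz.1.2 y hy
  have hzext : z ∈ P.extremePoints ℝ := hexp.isExtreme.extremePoints_subset_extremePoints hz
  have hzint : ∀ e, z e ∈ tmInt := by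
    by_contra hcon
    push Not at hcon
    let T : Bool → Set (Finset E) := fun b => {U | ∃ k, tag k = b ∧ S k = U ∧
        ((l k : ℝ) = ∑ e ∈ S k, z e ∨ ∑ e ∈ S k, z e = u k)}
    have hT : ∀ b, ∀ U ∈ T b, ∀ V ∈ T b, (U ∩ V).Nonempty → U ∩ V ∈ T b := by
      rintro b U ⟨k, hk, rfl, ht⟩ V ⟨k', hk', rfl, ht'⟩ hne
      exact hclos z hzP b k k' hk hk' ht ht' hne
    have hTi : ∀ b, ∀ U ∈ T b, ∑ e ∈ U, z e ∈ tmInt := by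
      rintro b U ⟨k, hk, rfl, ht⟩
      rw [tm_mem_int]
      rcases ht with ht | ht
      · exact ⟨l k, ht⟩
      · exact ⟨u k, ht.symm⟩
    obtain ⟨v, hv0, hvz, hv1, hv2⟩ := tm_dir (T false) (T true) (hT _) (hT _) z (hTi _) (hTi _) hcon
    have hvT : ∀ k, ((l k : ℝ) = ∑ e ∈ S k, z e ∨ ∑ e ∈ S k, z e = u k) → ∑ e ∈ S k, v e = 0 := by
      intro k hk
      cases hb : tag k
      · exact hv1 _ ⟨k, hb, rfl, hk⟩
      · exact hv2 _ ⟨k, hb, rfl, hk⟩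
    have hzP' := hzP
    rw [hP] at hzP'
    obtain ⟨hn, hk⟩ := hzP'
    have hlim : ∀ a b : ℝ, 0 < a → ∀ᶠ t in nhds (0 : ℝ), 0 < a + t * b := by
      intro a b ha
      have : Filter.Tendsto (fun t : ℝ => a + t * b) (nhds 0) (nhds (a + 0 * b)) :=
        Continuous.tendsto (by fun_prop) 0
      apply this.eventually_const_lt
      simpa using ha
    have hev : ∀ᶠ t in nhds (0 : ℝ), z + t • v ∈ P := by
      have e1 : ∀ᶠ t in nhds (0 : ℝ), ∀ e, 0 ≤ z e + t * v e := by
        rw [Filter.eventually_all]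
        intro e
        by_cases h : 0 < z e
        · filter_upwards [hlim _ (v e) h] with t ht using ht.le
        · have h0 : z e = 0 := le_antisymm (not_lt.1 h) (hn e)
          have : v e = 0 := hvz e (by rw [h0]; exact tmInt.zero_mem)
          simp [h0, this]
      have e2 : ∀ᶠ t in nhds (0 : ℝ), ∀ k, (l k : ℝ) ≤ ∑ e ∈ S k, z e + t * ∑ e ∈ S k, v e ∧
          ∑ e ∈ S k, z e + t * ∑ e ∈ S k, v e ≤ u k := by
        rw [Filter.eventually_all]
        intro k
        by_cases h : (l k : ℝ) = ∑ e ∈ S k, z e ∨ ∑ e ∈ S k, z e = u k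
        · simp [hvT k h, hk k]
        · push Not at h
          have h1 := lt_of_le_of_ne (hk k).1 h.1
          have h2 := lt_of_le_of_ne (hk k).2 h.2
          filter_upwards [hlim _ (∑ e ∈ S k, v e) (sub_pos.2 h1),
            hlim _ (-∑ e ∈ S k, v e) (sub_pos.2 h2)] with t t1 t2
          constructor <;> linarith
      filter_upwards [e1, e2] with t t1 t2
      rw [hP]
      refine ⟨fun e => by simpa using t1 e, fun k => ?_⟩
      have : ∑ e ∈ S k, (z + t • v) e = ∑ e ∈ S k, z e + t * ∑ e ∈ S k, v e := by
        simp [Finset.sum_add_distrib, Finset.mul_sum]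
      rw [this]; exact t2 k
    obtain ⟨ε, hε, hball⟩ := Metric.eventually_nhds_iff.1 hev
    have p1 : z + (ε / 2) • v ∈ P := hball (by rw [Real.dist_eq, sub_zero, abs_of_pos] <;> linarith)
    have p2 : z + (-(ε / 2)) • v ∈ P := hball (by
      rw [Real.dist_eq, sub_zero, abs_neg, abs_of_pos] <;> linarith)
    have hmid : z ∈ openSegment ℝ (z + (ε / 2) • v) (z + (-(ε / 2)) • v) := by
      refine ⟨1/2, 1/2, by norm_num, by norm_num, by norm_num, ?_⟩
      module
    have := hzext.2 p1 p2 hmid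
    apply hv0
    have h3 : (ε / 2) • v = 0 := by simpa using this
    rcases smul_eq_zero.1 h3 with h | h
    · linarith
    · exact h
  have hzint' : ∀ e, ∃ n : ℤ, (n : ℝ) = z e := fun e => tm_mem_int.1 (hzint e)
  choose n hn using hzint'
  have hnz : (fun e => (n e : ℝ)) = z := funext hn
  refine ⟨n, by rw [hnz]; exact hzP, ?_⟩
  rw [hφ, hφ] at hzy
  simp only [hn]
  linarith

/-- The side constraints of a (split) two-matroid median instance. -/
structure TMSys (E : Type*) where
  A : Finset E
  r1 : Finset E → ℤ
  r2 : Finset E → ℤ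
  l1 : ℤ
  u1 : ℤ
  l2 : ℤ
  u2 : ℤ
  l : ℤ
  u : ℤ

/-- Feasibility of a fractional opening vector. -/
structure TMSys.Feas {E : Type*} [Fintype E] (P : TMSys E) (z : E → ℝ) : Prop where
  nn : ∀ e, 0 ≤ z e
  h1 : ∀ S : Finset E, ∑ e ∈ S, z e ≤ (P.r1 S : ℝ)
  h2 : ∀ S : Finset E, ∑ e ∈ S \ P.A, z e ≤ (P.r2 (S \ P.A) : ℝ)
  b1l : (P.l1 : ℝ) ≤ ∑ e ∈ P.A, z e
  b1u : ∑ e ∈ P.A, z e ≤ (P.u1 : ℝ)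
  b2l : (P.l2 : ℝ) ≤ ∑ e ∈ P.Aᶜ, z e
  b2u : ∑ e ∈ P.Aᶜ, z e ≤ (P.u2 : ℝ)
  bl : (P.l : ℝ) ≤ ∑ e, z e
  bu : ∑ e, z e ≤ (P.u : ℝ)

theorem tm_tight_inter {E : Type*} (r : Finset E → ℤ)
    (hsub : ∀ S T, r (S ∩ T) + r (S ∪ T) ≤ r S + r T) (z : E → ℝ) (S T : Finset E)
    (hi : ∑ e ∈ S ∩ T, z e ≤ (r (S ∩ T) : ℝ)) (hu : ∑ e ∈ S ∪ T, z e ≤ (r (S ∪ T) : ℝ))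
    (hS : ∑ e ∈ S, z e = (r S : ℝ)) (hT : ∑ e ∈ T, z e = (r T : ℝ)) :
    ∑ e ∈ S ∩ T, z e = (r (S ∩ T) : ℝ) := by
  have h := Finset.sum_union_inter (s₁ := S) (s₂ := T) (f := z)
  have h2 : ((r (S ∩ T) : ℝ)) + r (S ∪ T) ≤ r S + r T := by exact_mod_cast hsub S T
  linarith

theorem tm_round {E J : Type*} [Fintype E] [Fintype J] (P : TMSys E)
    (hsub1 : ∀ S T, P.r1 (S ∩ T) + P.r1 (S ∪ T) ≤ P.r1 S + P.r1 T)
    (hsub2 : ∀ S T, P.r2 (S ∩ T) + P.r2 (S ∪ T) ≤ P.r2 S + P.r2 T)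
    (C : J → Finset E) (lC uC : J → ℤ) (hCA : ∀ j, C j ⊆ P.A)
    (hCd : ∀ j k, j ≠ k → Disjoint (C j) (C k))
    (w y : E → ℝ) (hy : P.Feas y)
    (hyl : ∀ j, (lC j : ℝ) ≤ ∑ e ∈ C j, y e) (hyu : ∀ j, ∑ e ∈ C j, y e ≤ (uC j : ℝ)) :
    ∃ z : E → ℤ, P.Feas (fun e => (z e : ℝ)) ∧ (∀ j, lC j ≤ ∑ e ∈ C j, z e) ∧
      (∀ j, ∑ e ∈ C j, z e ≤ uC j) ∧ ∑ e, w e * z e ≤ ∑ e, w e * y e := by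
  let S : Finset E ⊕ (Finset E ⊕ (J ⊕ Fin 3)) → Finset E :=
    Sum.elim id (Sum.elim (fun U => U \ P.A) (Sum.elim C ![P.A, P.Aᶜ, univ]))
  let l : Finset E ⊕ (Finset E ⊕ (J ⊕ Fin 3)) → ℤ :=
    Sum.elim (fun _ => -1) (Sum.elim (fun _ => -1) (Sum.elim lC ![P.l1, P.l2, P.l]))
  let u : Finset E ⊕ (Finset E ⊕ (J ⊕ Fin 3)) → ℤ :=
    Sum.elim P.r1 (Sum.elim (fun U => P.r2 (U \ P.A)) (Sum.elim uC ![P.u1, P.u2, P.u]))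
  let Q : Set (E → ℝ) := {z : E → ℝ | (∀ e, 0 ≤ z e) ∧ ∀ k, (l k : ℝ) ≤ ∑ e ∈ S k, z e ∧
      ∑ e ∈ S k, z e ≤ (u k : ℝ)}
  have hQ : ∀ z, z ∈ Q ↔ P.Feas z ∧ (∀ j, (lC j : ℝ) ≤ ∑ e ∈ C j, z e) ∧
      (∀ j, ∑ e ∈ C j, z e ≤ (uC j : ℝ)) := by
    intro z
    constructor
    · rintro ⟨hn, hk⟩
      refine ⟨⟨hn, fun U => (hk (.inl U)).2, fun U => (hk (.inr (.inl U))).2,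
        (hk (.inr (.inr (.inr 0)))).1, (hk (.inr (.inr (.inr 0)))).2,
        (hk (.inr (.inr (.inr 1)))).1, (hk (.inr (.inr (.inr 1)))).2,
        (hk (.inr (.inr (.inr 2)))).1, (hk (.inr (.inr (.inr 2)))).2⟩,
        fun j => (hk (.inr (.inr (.inl j)))).1, fun j => (hk (.inr (.inr (.inl j)))).2⟩
    · rintro ⟨hF, h1, h2⟩
      refine ⟨hF.nn, ?_⟩
      have hpos : ∀ U : Finset E, ((-1 : ℤ) : ℝ) ≤ ∑ e ∈ U, z e := fun U => by
        have := Finset.sum_nonneg (s := U) (fun e _ => hF.nn e)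
        push_cast; linarith
      rintro (U | U | j | i)
      · exact ⟨hpos _, hF.h1 U⟩
      · exact ⟨hpos _, hF.h2 U⟩
      · exact ⟨h1 j, h2 j⟩
      · fin_cases i
        · exact ⟨hF.b1l, hF.b1u⟩
        · exact ⟨hF.b2l, hF.b2u⟩
        · exact ⟨hF.bl, hF.bu⟩
  -- laminarity
  have hlam : ∀ a b : J ⊕ Fin 3, (S (.inr (.inr a)) ∩ S (.inr (.inr b))).Nonempty →
      S (.inr (.inr a)) ∩ S (.inr (.inr b)) = S (.inr (.inr a)) ∨
      S (.inr (.inr a)) ∩ S (.inr (.inr b)) = S (.inr (.inr b)) := by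
    have hJ : ∀ j i, (C j ∩ ![P.A, P.Aᶜ, univ] i).Nonempty →
        C j ∩ ![P.A, P.Aᶜ, univ] i = C j := by
      intro j i
      fin_cases i
      · intro _; exact Finset.inter_eq_left.2 (hCA j)
      · rintro ⟨e, he⟩
        simp at he
        exact absurd (hCA j he.1) he.2
      · intro _; simp
    rintro (j | i) (j' | i') hne
    · by_cases hjj : j = j'
      · subst hjj; left; simp
      · exact absurd (Finset.disjoint_iff_inter_eq_empty.1 (hCd j j' hjj)) hne.ne_empty
    · left; exact hJ j i' hne
    · right
      rw [Finset.inter_comm] at hne ⊢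
      exact hJ j' i hne
    · clear hQ
      simp only [S, Sum.elim_inr] at hne ⊢
      fin_cases i <;> fin_cases i' <;> simp at hne ⊢
      exfalso
      rw [Finset.inter_comm] at hne
      simp at hne
  have hlam2 : ∀ (U : Finset E) (a : J ⊕ Fin 3), ((U \ P.A) ∩ S (.inr (.inr a))).Nonempty →
      (U \ P.A) ∩ S (.inr (.inr a)) = U \ P.A := by
    rintro U (j | i) hne
    · obtain ⟨e, he⟩ := hne
      rw [Finset.mem_inter, Finset.mem_sdiff] at he
      exact absurd (hCA j he.2) he.1.2
    · simp only [S, Sum.elim_inr] at hne ⊢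
      fin_cases i
      · simp at hne
      · ext e; simp
      · simp
  have hfin := tm_extreme S l u Sum.isRight (∑ e, |(P.r1 {e} : ℝ)|) Q rfl ?_ ?_ w y
    ((hQ y).2 ⟨hy, hyl, hyu⟩)
  · obtain ⟨z, hz, hc⟩ := hfin
    obtain ⟨h1, h2, h3⟩ := (hQ _).1 hz
    exact ⟨z, h1, fun j => by exact_mod_cast h2 j, fun j => by exact_mod_cast h3 j, hc⟩
  · intro z hz e
    have h1 := ((hQ z).1 hz).1.h1 {e}
    rw [Finset.sum_singleton] at h1
    calc z e ≤ (P.r1 {e} : ℝ) := h1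
      _ ≤ |(P.r1 {e} : ℝ)| := le_abs_self _
      _ ≤ _ := Finset.single_le_sum (f := fun e => |(P.r1 {e} : ℝ)|) (fun _ _ => abs_nonneg _)
        (Finset.mem_univ e)
  · intro z hz b k k' hk hk' ht ht' hne
    have hF := ((hQ z).1 hz).1
    have hpos : ∀ U : Finset E, ((-1 : ℤ) : ℝ) ≠ ∑ e ∈ U, z e := fun U => by
      have := Finset.sum_nonneg (s := U) (fun e _ => hF.nn e)
      push_cast; intro h; linarith
    cases b
    · rcases k with U | k
      swap
      · simp at hk
      rcases k' with V | k'
      swap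
      · simp at hk'
      have tU := ht.resolve_left (hpos _)
      have tV := ht'.resolve_left (hpos _)
      refine ⟨.inl (U ∩ V), rfl, rfl, Or.inr ?_⟩
      exact tm_tight_inter P.r1 hsub1 z U V (hF.h1 _) (hF.h1 _) tU tV
    · rcases k with U | k
      · simp at hk
      rcases k' with V | k'
      · simp at hk'
      rcases k with U | a
      · rcases k' with V | a'
        · have tU := ht.resolve_left (hpos _)
          have tV := ht'.resolve_left (hpos _)
          have e1 : (U \ P.A) ∩ (V \ P.A) = (U ∩ V) \ P.A := by
            ext e; simp; tauto
          have e2 : (U \ P.A) ∪ (V \ P.A) = (U ∪ V) \ P.A := by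
            ext e; simp; tauto
          refine ⟨.inr (.inl (U ∩ V)), rfl, e1.symm, Or.inr ?_⟩
          have := tm_tight_inter P.r2 hsub2 z (U \ P.A) (V \ P.A)
            (by rw [e1]; exact hF.h2 _) (by rw [e2]; exact hF.h2 _) tU tV
          rw [e1] at this
          exact this
        · exact ⟨.inr (.inl U), rfl, (hlam2 U a' hne).symm, ht⟩
      · rcases k' with V | a'
        · refine ⟨.inr (.inl V), rfl, ?_, ht'⟩
          rw [Finset.inter_comm] at hne ⊢
          exact (hlam2 V a hne).symm
        · rcases hlam a a' hne with h | h
          · exact ⟨_, rfl, h.symm, ht⟩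
          · exact ⟨_, rfl, h.symm, ht'⟩

theorem tm_greedy {α : Type*} (key : α → ℝ) (conf : α → α → Prop)
    (hconf : ∀ j k, conf j k → conf k j) (s : Finset α) :
    ∃ Q ⊆ s, (∀ j ∈ Q, ∀ k ∈ Q, j ≠ k → ¬ conf j k) ∧
      ∀ k ∈ s, ∃ j ∈ Q, key j ≤ key k ∧ (j = k ∨ conf j k) := by
  induction s using Finset.strongInduction with
  | H s ih =>
    rcases s.eq_empty_or_nonempty with rfl | hne
    · exact ⟨∅, by simp⟩
    obtain ⟨j0, hj0, hmin⟩ := Finset.exists_min_image s key hne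
    obtain ⟨Q, hQs, hQ1, hQ2⟩ := ih (s.filter (fun k => k ≠ j0 ∧ ¬ conf j0 k))
      (Finset.filter_ssubset.2 ⟨j0, hj0, by simp⟩)
    have hQ0 : ∀ k ∈ Q, k ∈ s ∧ k ≠ j0 ∧ ¬ conf j0 k := fun k hk => by
      simpa using hQs hk
    refine ⟨insert j0 Q, ?_, ?_, ?_⟩
    · intro k hk
      rcases Finset.mem_insert.1 hk with rfl | hk
      · exact hj0
      · exact (hQ0 k hk).1
    · intro j hj k hk hjk
      rcases Finset.mem_insert.1 hj with h1 | h1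
      · rcases Finset.mem_insert.1 hk with h2 | h2
        · exact absurd (h1.trans h2.symm) hjk
        · rw [h1]; exact (hQ0 k h2).2.2
      · rcases Finset.mem_insert.1 hk with h2 | h2
        · rw [h2]; exact fun h => (hQ0 j h1).2.2 (hconf _ _ h)
        · exact hQ1 j h1 k h2 hjk
    · intro k hk
      by_cases hkk : k ≠ j0 ∧ ¬ conf j0 k
      · obtain ⟨j, hj, h⟩ := hQ2 k (by simp [hk, hkk])
        exact ⟨j, Finset.mem_insert_of_mem hj, h⟩
      · refine ⟨j0, Finset.mem_insert_self _ _, hmin k hk, ?_⟩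
        by_cases h : k = j0
        · left; exact h.symm
        · right; by_contra h2; exact hkk ⟨h, h2⟩

theorem tm_rank_eq {α : Type*} (M : Matroid α) (S : Finset α) :
    ((matroidRank M S : ℕ) : ℕ∞) = M.eRk ↑S := by
  apply le_antisymm
  · obtain ⟨I, hI, hc⟩ := Finset.exists_mem_eq_sup (S.powerset.filter (fun I : Finset α => M.Indep ↑I))
      ⟨∅, by simp⟩ Finset.card
    simp only [Finset.mem_filter, Finset.mem_powerset] at hI
    unfold matroidRank
    rw [hc, ← Set.encard_coe_eq_coe_finsetCard]
    exact hI.2.encard_le_eRk_of_subset (by exact_mod_cast hI.1)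
  · rw [Matroid.eRk_le_iff]
    intro I hIS hI
    have hfin : I.Finite := S.finite_toSet.subset hIS
    have h1 : I = ↑hfin.toFinset := by simp
    rw [h1, Set.encard_coe_eq_coe_finsetCard]
    norm_cast
    apply Finset.le_sup (f := Finset.card)
    simp only [Finset.mem_filter, Finset.mem_powerset]
    exact ⟨by intro e he; simp at he; exact_mod_cast hIS he, by rw [← h1]; exact hI⟩

theorem tm_rank_mono {α : Type*} (M : Matroid α) {S T : Finset α} (h : S ⊆ T) :
    matroidRank M S ≤ matroidRank M T := by
  have := M.eRk_mono (show (S : Set α) ⊆ T by exact_mod_cast h)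
  rw [← tm_rank_eq, ← tm_rank_eq] at this
  exact_mod_cast this

theorem tm_rank_submod {α : Type*} (M : Matroid α) (S T : Finset α) :
    matroidRank M (S ∩ T) + matroidRank M (S ∪ T) ≤ matroidRank M S + matroidRank M T := by
  have := M.eRk_inter_add_eRk_union_le S T
  rw [← Finset.coe_inter, ← Finset.coe_union, ← tm_rank_eq, ← tm_rank_eq, ← tm_rank_eq,
    ← tm_rank_eq] at this
  exact_mod_cast this

theorem tm_rank_le_card {α : Type*} (M : Matroid α) (S : Finset α) :
    matroidRank M S ≤ #S := by
  apply Finset.sup_le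
  intro I hI
  simp only [Finset.mem_filter, Finset.mem_powerset] at hI
  exact Finset.card_le_card hI.1

theorem tm_indep_of_rank {α : Type*} (M : Matroid α) (S : Finset α) (h : #S ≤ matroidRank M S) :
    M.Indep ↑S := by
  obtain ⟨I, hI, hc⟩ := Finset.exists_mem_eq_sup (S.powerset.filter (fun I : Finset α => M.Indep ↑I))
      ⟨∅, by simp⟩ Finset.card
  simp only [Finset.mem_filter, Finset.mem_powerset] at hI
  have : I = S := Finset.eq_of_subset_of_card_le hI.1 (by rw [← hc]; exact h)
  rw [← this]; exact hI.2

theorem tm_round_obj {E J D : Type*} [Fintype E] [Fintype J] [Fintype D] (P : TMSys E)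
    (hsub1 : ∀ S T, P.r1 (S ∩ T) + P.r1 (S ∪ T) ≤ P.r1 S + P.r1 T)
    (hsub2 : ∀ S T, P.r2 (S ∩ T) + P.r2 (S ∪ T) ≤ P.r2 S + P.r2 T)
    (C : J → Finset E) (lC uC : J → ℤ) (hCA : ∀ j, C j ⊆ P.A)
    (hCd : ∀ j k, j ≠ k → Disjoint (C j) (C k))
    (f : E → ℝ) (d κ : D → ℝ) (g : D → E → ℝ) (y : E → ℝ) (hy : P.Feas y)
    (hyl : ∀ j, (lC j : ℝ) ≤ ∑ e ∈ C j, y e) (hyu : ∀ j, ∑ e ∈ C j, y e ≤ (uC j : ℝ)) :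
    ∃ z : E → ℤ, P.Feas (fun e => (z e : ℝ)) ∧ (∀ j, lC j ≤ ∑ e ∈ C j, z e) ∧
      (∀ j, ∑ e ∈ C j, z e ≤ uC j) ∧
      ∑ e, f e * z e + ∑ k, d k * (κ k + ∑ e, g k e * z e) ≤
        ∑ e, f e * y e + ∑ k, d k * (κ k + ∑ e, g k e * y e) := by
  obtain ⟨z, h1, h2, h3, h4⟩ := tm_round P hsub1 hsub2 C lC uC hCA hCd
    (fun e => f e + ∑ k, d k * g k e) y hy hyl hyu
  refine ⟨z, h1, h2, h3, ?_⟩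
  have key : ∀ v : E → ℝ, ∑ e, f e * v e + ∑ k, d k * (κ k + ∑ e, g k e * v e)
      = ∑ e, (f e + ∑ k, d k * g k e) * v e + ∑ k, d k * κ k := by
    intro v
    have h : ∑ e, (∑ k, d k * g k e) * v e = ∑ k, d k * ∑ e, g k e * v e := by
      simp only [Finset.sum_mul, Finset.mul_sum]
      rw [Finset.sum_comm]
      simp only [mul_assoc]
    simp only [add_mul, mul_add, Finset.sum_add_distrib, h]
    ring
  rw [key, key y]
  linarith

/-- All bounds doubled. -/
def TMSys.dbl {E : Type*} (P : TMSys E) : TMSys E where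
  A := P.A
  r1 := fun S => 2 * P.r1 S
  r2 := fun S => 2 * P.r2 S
  l1 := 2 * P.l1
  u1 := 2 * P.u1
  l2 := 2 * P.l2
  u2 := 2 * P.u2
  l := 2 * P.l
  u := 2 * P.u

theorem TMSys.feas_dbl {E : Type*} [Fintype E] (P : TMSys E) (z : E → ℝ) :
    P.dbl.Feas (fun e => 2 * z e) ↔ P.Feas z := by
  constructor
  · rintro ⟨a1, a2, a3, a4, a5, a6, a7, a8, a9⟩
    simp only [TMSys.dbl, ← Finset.mul_sum] at a2 a3 a4 a5 a6 a7 a8 a9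
    push_cast at a2 a3 a4 a5 a6 a7 a8 a9
    exact ⟨fun e => by linarith [a1 e], fun S => by linarith [a2 S], fun S => by linarith [a3 S],
      by linarith, by linarith, by linarith, by linarith, by linarith, by linarith⟩
  · rintro ⟨a1, a2, a3, a4, a5, a6, a7, a8, a9⟩
    constructor <;> (try simp only [TMSys.dbl, ← Finset.mul_sum]) <;> push_cast
    · exact fun e => by linarith [a1 e]
    · exact fun e => by linarith [a2 e]
    · exact fun e => by linarith [a3 e]
    all_goals linarith

/-- The proxy connection cost of a center. -/
noncomputable def tmT {E D : Type*} (cE : E → D → ℝ) (B : D → Finset E) (Dm : D → ℝ)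
    (z : E → ℝ) (j : D) : ℝ :=
  2 * ∑ e ∈ B j, cE e j * z e + 2 * Dm j * (1 - ∑ e ∈ B j, z e)

theorem tm_half {E D : Type*} [Fintype E] [Fintype D] (P : TMSys E)
    (hsub1 : ∀ S T, P.r1 (S ∩ T) + P.r1 (S ∪ T) ≤ P.r1 S + P.r1 T)
    (hsub2 : ∀ S T, P.r2 (S ∩ T) + P.r2 (S ∪ T) ≤ P.r2 S + P.r2 T)
    (cE : E → D → ℝ) (Dm : D → ℝ) (N : Finset D) (B : D → Finset E)
    (hBA : ∀ j ∈ N, B j ⊆ P.A)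
    (hBd : ∀ j ∈ N, ∀ k ∈ N, j ≠ k → Disjoint (B j) (B k))
    (f : E → ℝ) (d : D → ℝ) (φ : D → D)
    (y : E → ℝ) (hy : P.Feas y)
    (hy1 : ∀ j ∈ N, 1 / 2 ≤ ∑ e ∈ B j, y e) (hy2 : ∀ j ∈ N, ∑ e ∈ B j, y e ≤ 1)
    (hout : ∀ j ∈ N, ∑ e ∈ B j, y e < 1 → ∃ k ∈ N, k ≠ j) :
    ∃ Z : E → ℤ, P.Feas (fun e => (Z e : ℝ) / 2) ∧
      (∀ j ∈ N, ∑ e ∈ B j, Z e = 2 ∨ (∑ e ∈ B j, Z e = 1 ∧ ∃ k ∈ N, k ≠ j)) ∧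
      ∑ e, f e * ((Z e : ℝ) / 2) + ∑ k, d k * tmT cE B Dm (fun e => (Z e : ℝ) / 2) (φ k) ≤
        ∑ e, f e * y e + ∑ k, d k * tmT cE B Dm y (φ k) := by
  obtain ⟨Z, hZ, hl, hu, hc⟩ := tm_round_obj (J := {j // j ∈ N}) P.dbl
    (fun S T => by have := hsub1 S T; simp only [TMSys.dbl]; linarith)
    (fun S T => by have := hsub2 S T; simp only [TMSys.dbl]; linarith)
    (fun j => B j) (fun j => if ∑ e ∈ B j.1, y e < 1 then 1 else 2) (fun _ => 2)
    (fun j => hBA j j.2) (fun j k hjk => hBd j j.2 k k.2 (fun h => hjk (Subtype.ext h)))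
    (fun e => f e / 2) d (fun k => 2 * Dm (φ k))
    (fun k e => if e ∈ B (φ k) then cE e (φ k) - Dm (φ k) else 0)
    (fun e => 2 * y e) ((P.feas_dbl y).2 hy)
    (by
      intro j
      rw [← Finset.mul_sum]
      have := hy1 j j.2
      split_ifs with h
      · push_cast; linarith
      · push_cast; linarith)
    (by
      intro j
      rw [← Finset.mul_sum]
      have := hy2 j j.2
      push_cast; linarith)
  have key : ∀ v : E → ℝ, ∑ e, f e / 2 * (2 * v e) + ∑ k, d k * (2 * Dm (φ k) +
      ∑ e, (if e ∈ B (φ k) then cE e (φ k) - Dm (φ k) else 0) * (2 * v e))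
      = ∑ e, f e * v e + ∑ k, d k * tmT cE B Dm v (φ k) := by
    intro v
    congr 1
    · apply Finset.sum_congr rfl; intro e _; ring
    · apply Finset.sum_congr rfl; intro k _
      congr 1
      unfold tmT
      simp only [ite_mul, zero_mul, Finset.sum_ite_mem, Finset.univ_inter, sub_mul,
        Finset.sum_sub_distrib, mul_sub, Finset.mul_sum]
      have e1 : ∑ x ∈ B (φ k), cE x (φ k) * (2 * v x) = ∑ x ∈ B (φ k), 2 * (cE x (φ k) * v x) :=
        Finset.sum_congr rfl fun _ _ => by ring
      have e2 : ∑ x ∈ B (φ k), Dm (φ k) * (2 * v x) = ∑ x ∈ B (φ k), 2 * Dm (φ k) * v x :=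
        Finset.sum_congr rfl fun _ _ => by ring
      rw [e1, e2]; ring
  have hZ2 : (fun e => (Z e : ℝ)) = fun e => 2 * ((Z e : ℝ) / 2) := by ext e; ring
  refine ⟨Z, ?_, ?_, ?_⟩
  · rw [← P.feas_dbl, ← hZ2]; exact hZ
  · intro j hj
    have h1 := hl ⟨j, hj⟩
    have h2 := hu ⟨j, hj⟩
    try simp only at h1
    try simp only at h2
    split_ifs at h1 with h
    · rcases (show ∑ e ∈ B j, Z e = 2 ∨ ∑ e ∈ B j, Z e = 1 by omega) with h3 | h3
      · exact Or.inl h3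
      · exact Or.inr ⟨h3, hout j hj h⟩
    · left; omega
  · have k1 := key (fun e => (Z e : ℝ) / 2)
    have k2 := key y
    rw [← k1, ← k2]
    have e3 : ∀ e, 2 * ((Z e : ℝ) / 2) = Z e := fun e => by ring
    simp only [e3]
    exact hc

theorem tm_sum_one {E : Type*} (S : Finset E) (z : E → ℤ) (hz : ∀ e, 0 ≤ z e)
    (h : ∑ e ∈ S, z e = 1) : ∃ e ∈ S, z e = 1 ∧ ∀ e' ∈ S, e' ≠ e → z e' = 0 := by
  have hne : ∃ e ∈ S, z e ≠ 0 := by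
    by_contra hcon
    push Not at hcon
    rw [Finset.sum_eq_zero hcon] at h
    omega
  obtain ⟨e, he, hze⟩ := hne
  have h1 := Finset.add_sum_erase S z he
  have h2 : 0 ≤ ∑ x ∈ S.erase e, z x := Finset.sum_nonneg fun x _ => hz x
  have h3 := hz e
  refine ⟨e, he, by omega, fun e' he' hne' => ?_⟩
  have h4 := Finset.single_le_sum (s := S.erase e) (f := z) (fun x _ => hz x)
    (Finset.mem_erase.2 ⟨hne', he'⟩)
  have := hz e'
  omega

theorem tm_int {E D : Type*} [Fintype E] [Fintype D] (P : TMSys E)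
    (hsub1 : ∀ S T, P.r1 (S ∩ T) + P.r1 (S ∪ T) ≤ P.r1 S + P.r1 T)
    (hsub2 : ∀ S T, P.r2 (S ∩ T) + P.r2 (S ∪ T) ≤ P.r2 S + P.r2 T)
    (hr1 : ∀ e, P.r1 {e} ≤ 1)
    (cE : E → D → ℝ) (cD : D → D → ℝ) (N : Finset D) (B : D → Finset E)
    (hcE : ∀ e j, 0 ≤ cE e j) (hcD : ∀ j k, 0 ≤ cD j k) (hsymm : ∀ j k, cD j k = cD k j)
    (htri : ∀ e ∈ P.A, ∀ j k, cE e k ≤ cE e j + cD j k)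
    (hBA : ∀ j ∈ N, B j ⊆ P.A)
    (hBd : ∀ j ∈ N, ∀ k ∈ N, j ≠ k → Disjoint (B j) (B k))
    (hBall : ∀ j ∈ N, ∀ e ∈ B j, ∀ k ∈ N, k ≠ j → 2 * cE e j ≤ cD j k)
    (sg : D → D) (hsg : ∀ j ∈ N, (∃ k ∈ N, k ≠ j) → sg j ∈ N ∧ sg j ≠ j)
    (f : E → ℝ) (d : D → ℝ) (hd : ∀ k, 0 ≤ d k) (φ : D → D) (hφ : ∀ k, φ k ∈ N)
    (Z : E → ℤ) (hZ : P.Feas (fun e => (Z e : ℝ) / 2))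
    (hZB : ∀ j ∈ N, ∑ e ∈ B j, Z e = 2 ∨ (∑ e ∈ B j, Z e = 1 ∧ ∃ k ∈ N, k ≠ j)) :
    ∃ z : E → ℤ, P.Feas (fun e => (z e : ℝ)) ∧ ∃ o : D → E, (∀ j ∈ N, o j ∈ P.A ∧ z (o j) = 1) ∧
      ∑ e, f e * (z e : ℝ) + ∑ k, d k * cE (o (φ k)) (φ k) ≤
      ∑ e, f e * ((Z e : ℝ) / 2) +
        ∑ k, d k * tmT cE B (fun j => cD j (sg j)) (fun e => (Z e : ℝ) / 2) (φ k) := by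
  rcases isEmpty_or_nonempty E with hE | hE
  · have hNe : ∀ j, j ∉ N := fun j hj => by
      have h0 : ∑ e ∈ B j, Z e = 0 := Finset.sum_eq_zero fun e _ => hE.elim e
      rcases hZB j hj with h | h
      · omega
      · have := h.1
        omega
    have hDe : IsEmpty D := ⟨fun k => hNe _ (hφ k)⟩
    refine ⟨Z, ?_, fun k => hDe.elim k, fun j => hDe.elim j, by simp⟩
    have : (fun e => (Z e : ℝ)) = fun e => (Z e : ℝ) / 2 := funext fun e => hE.elim e
    rw [this]
    exact hZ
  have hZ0 : ∀ e, 0 ≤ Z e := fun e => by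
    have := hZ.nn e
    have h : (0 : ℝ) ≤ Z e := by linarith
    exact_mod_cast h
  set N1 := N.filter (fun j => ∑ e ∈ B j, Z e = 2) with hN1
  set Nh := N.filter (fun j => ∑ e ∈ B j, Z e = 1) with hNh
  have mN1 : ∀ j, j ∈ N1 ↔ j ∈ N ∧ ∑ e ∈ B j, Z e = 2 := fun j => by rw [hN1, Finset.mem_filter]
  have mNh : ∀ j, j ∈ Nh ↔ j ∈ N ∧ ∑ e ∈ B j, Z e = 1 := fun j => by rw [hNh, Finset.mem_filter]
  have hcase : ∀ j ∈ N, j ∈ N1 ∨ j ∈ Nh := fun j hj => by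
    rw [mN1, mNh]
    rcases hZB j hj with h | h
    · exact Or.inl ⟨hj, h⟩
    · exact Or.inr ⟨hj, h.1⟩
  have hsg' : ∀ j ∈ Nh, sg j ∈ N ∧ sg j ≠ j := fun j hj => by
    rw [mNh] at hj
    rcases hZB j hj.1 with h | h
    · omega
    · exact hsg j hj.1 h.2
  have hi : ∀ j ∈ Nh, ∃ e ∈ B j, Z e = 1 ∧ ∀ e' ∈ B j, e' ≠ e → Z e' = 0 := fun j hj =>
    tm_sum_one _ _ hZ0 ((mNh j).1 hj).2
  choose! i1 hi1 hi2 hi3 using hi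
  let a : D → ℝ := fun j => cE (i1 j) j
  let key : D → ℝ := fun k => a k + cD k (sg k) + a (sg k)
  let conf : D → D → Prop := fun j k => j = k ∨ j = sg k ∨ sg j = k ∨ sg j = sg k
  obtain ⟨Q, hQs, hQ1, hQ2⟩ := tm_greedy key conf
    (by intro j k h; simp only [conf] at h ⊢; tauto) (Nh.filter (fun k => sg k ∈ Nh))
  have mQ : ∀ j ∈ Q, j ∈ Nh ∧ sg j ∈ Nh := fun j hj => by simpa using hQs hj
  have inN : ∀ j ∈ Nh, j ∈ N := fun j hj => ((mNh j).1 hj).1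
  have sameB : ∀ j ∈ N, ∀ k ∈ N, ∀ e, e ∈ B j → e ∈ B k → j = k := fun j hj k hk e h1 h2 => by
    by_contra hne
    exact Finset.disjoint_left.1 (hBd j hj k hk hne) h1 h2
  -- the pairs
  have hpair : ∀ j ∈ Q, i1 j ≠ i1 (sg j) := fun j hj h => by
    have h1 := hi1 j (mQ j hj).1
    have h2 := hi1 _ (mQ j hj).2
    rw [← h] at h2
    exact (hsg' j (mQ j hj).1).2 (sameB _ (inN _ (mQ j hj).1) _ (inN _ (mQ j hj).2) _ h1 h2).symm
  obtain ⟨z, hz, hzl, hzu, hc⟩ := tm_round_obj (J := {j // j ∈ N1} ⊕ {j // j ∈ Q}) P hsub1 hsub2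
    (Sum.elim (fun j => B j.1) (fun j => {i1 j.1, i1 (sg j.1)})) (fun _ => 1) (fun _ => 1)
    (by
      rintro (⟨j, hj⟩ | ⟨j, hj⟩)
      · exact hBA j ((mN1 j).1 hj).1
      · intro e he
        simp only [Sum.elim_inr, Finset.mem_insert, Finset.mem_singleton] at he
        rcases he with rfl | rfl
        · exact hBA j (inN _ (mQ j hj).1) (hi1 _ (mQ j hj).1)
        · exact hBA _ (inN _ (mQ j hj).2) (hi1 _ (mQ j hj).2))
    (by
      have hmix : ∀ j ∈ N1, ∀ k ∈ Q, Disjoint (B j) ({i1 k, i1 (sg k)} : Finset E) := by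
        intro j hj k hk
        have hjN := (mN1 j).1 hj
        have haux : ∀ m ∈ Nh, i1 m ∉ B j := fun m hm hmem => by
          have := sameB j hjN.1 m (inN m hm) _ hmem (hi1 m hm)
          subst this
          have := ((mNh j).1 hm).2
          omega
        rw [Finset.disjoint_right]
        intro e he
        simp only [Finset.mem_insert, Finset.mem_singleton] at he
        rcases he with rfl | rfl
        · exact haux _ (mQ k hk).1
        · exact haux _ (mQ k hk).2
      rintro (⟨j, hj⟩ | ⟨j, hj⟩) (⟨k, hk⟩ | ⟨k, hk⟩) hne
      · exact hBd j ((mN1 j).1 hj).1 k ((mN1 k).1 hk).1 (fun h => hne (by subst h; rfl))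
      · exact hmix j hj k hk
      · exact (hmix k hk j hj).symm
      · have hjk : j ≠ k := fun h => hne (by subst h; rfl)
        have hnc := hQ1 j hj k hk hjk
        simp only [Sum.elim_inr]
        rw [Finset.disjoint_left]
        intro e he he'
        simp only [Finset.mem_insert, Finset.mem_singleton] at he he'
        apply hnc
        have haux : ∀ m ∈ Nh, ∀ m' ∈ Nh, e = i1 m → e = i1 m' → m = m' := by
          intro m hm m' hm' h h'
          refine sameB m (inN m hm) m' (inN m' hm') e (h ▸ hi1 m hm) (h' ▸ hi1 m' hm')
        have mj := mQ j hj
        have mk := mQ k hk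
        rcases he with h | h <;> rcases he' with h' | h'
        · exact Or.inl (haux _ mj.1 _ mk.1 h h')
        · exact Or.inr (Or.inl (haux _ mj.1 _ mk.2 h h'))
        · exact Or.inr (Or.inr (Or.inl (haux _ mj.2 _ mk.1 h h')))
        · exact Or.inr (Or.inr (Or.inr (haux _ mj.2 _ mk.2 h h'))))
    f d (fun k => if φ k ∈ N1 then 0 else a (φ k) + 2 * cD (φ k) (sg (φ k)))
    (fun k e => if φ k ∈ N1 then (if e ∈ B (φ k) then cE e (φ k) else 0)
      else (if e = i1 (φ k) then -(2 * cD (φ k) (sg (φ k))) else 0))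
    (fun e => (Z e : ℝ) / 2) hZ
    (by
      rintro (⟨j, hj⟩ | ⟨j, hj⟩)
      · have h : ((∑ e ∈ B j, Z e : ℤ) : ℝ) = 2 := by rw [((mN1 j).1 hj).2]; norm_num
        simp only [Sum.elim_inl, ← Finset.sum_div]
        push_cast at h ⊢; linarith
      · simp only [Sum.elim_inr]
        rw [Finset.sum_pair (hpair j hj), hi2 _ (mQ j hj).1, hi2 _ (mQ j hj).2]
        norm_num)
    (by
      rintro (⟨j, hj⟩ | ⟨j, hj⟩)
      · have h : ((∑ e ∈ B j, Z e : ℤ) : ℝ) = 2 := by rw [((mN1 j).1 hj).2]; norm_num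
        simp only [Sum.elim_inl, ← Finset.sum_div]
        push_cast at h ⊢; linarith
      · simp only [Sum.elim_inr]
        rw [Finset.sum_pair (hpair j hj), hi2 _ (mQ j hj).1, hi2 _ (mQ j hj).2]
        norm_num)
  have hz0 : ∀ e, 0 ≤ z e := fun e => by
    have := hz.nn e
    exact_mod_cast this
  have hz1 : ∀ e, z e ≤ 1 := fun e => by
    have := hz.h1 {e}
    rw [Finset.sum_singleton] at this
    have h2 : z e ≤ P.r1 {e} := by exact_mod_cast this
    exact h2.trans (hr1 e)
  have hz01 : ∀ e, z e = 0 ∨ z e = 1 := fun e => by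
    have := hz0 e
    have := hz1 e
    omega
  -- served fully
  have hfull : ∀ j ∈ N1, ∃ e ∈ B j, z e = 1 ∧ ∀ e' ∈ B j, e' ≠ e → z e' = 0 := fun j hj => by
    apply tm_sum_one _ _ hz0
    have h1 := hzl (.inl ⟨j, hj⟩)
    have h2 := hzu (.inl ⟨j, hj⟩)
    exact le_antisymm h2 h1
  have hone : ∀ j ∈ Q, z (i1 j) = 1 ∨ z (i1 (sg j)) = 1 := fun j hj => by
    have h1 := hzl (.inr ⟨j, hj⟩)
    simp only [Sum.elim_inr] at h1
    rw [Finset.sum_pair (hpair j hj)] at h1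
    rcases hz01 (i1 j) with h | h
    · right
      have := hz1 (i1 (sg j))
      omega
    · left; exact h
  have hi1A : ∀ j ∈ Nh, i1 j ∈ P.A := fun j hj => hBA j (inN j hj) (hi1 j hj)
  -- half-served centers
  have hhalf : ∀ k ∈ Nh, ∃ e ∈ P.A, z e = 1 ∧
      cE e k ≤ a k + 2 * cD k (sg k) - 2 * cD k (sg k) * z (i1 k) := by
    intro k hk
    rcases hz01 (i1 k) with h0 | h1
    swap
    · refine ⟨i1 k, hi1A k hk, h1, ?_⟩
      rw [h1]; push_cast
      have : cE (i1 k) k = a k := rfl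
      linarith
    rw [h0]
    have hs := hsg' k hk
    have hak : 0 ≤ a k := hcE _ _
    have hDk : 0 ≤ cD k (sg k) := hcD _ _
    suffices h : ∃ e ∈ P.A, z e = 1 ∧ cE e k ≤ a k + 2 * cD k (sg k) by
      obtain ⟨e, h1, h2, h3⟩ := h
      exact ⟨e, h1, h2, by push_cast; linarith⟩
    rcases hcase _ hs.1 with hl | hl
    · obtain ⟨e, he, hze, -⟩ := hfull _ hl
      have heA := hBA _ hs.1 he
      have hb := hBall _ hs.1 e he k (inN k hk) hs.2.symm
      have ht := htri e heA (sg k) k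
      rw [hsymm (sg k) k] at hb ht
      exact ⟨e, heA, hze, by linarith⟩
    · have hal : 2 * a (sg k) ≤ cD k (sg k) := by
        have hb := hBall _ hs.1 _ (hi1 _ hl) k (inN k hk) hs.2.symm
        rw [hsymm (sg k) k] at hb
        exact hb
      -- if the neighbour is open
      have hopen : z (i1 (sg k)) = 1 → ∃ e ∈ P.A, z e = 1 ∧ cE e k ≤ a k + 2 * cD k (sg k) := by
        intro h
        refine ⟨i1 (sg k), hi1A _ hl, h, ?_⟩
        have ht := htri _ (hi1A _ hl) (sg k) k
        rw [hsymm (sg k) k] at ht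
        have : cE (i1 (sg k)) (sg k) = a (sg k) := rfl
        linarith
      obtain ⟨j, hjQ, hkey, hjk⟩ := hQ2 k (by simp [hk, hl])
      have hjN := mQ j hjQ
      have hkey' : a j + cD j (sg j) + a (sg j) ≤ a k + cD k (sg k) + a (sg k) := hkey
      have haj : 0 ≤ a j := hcE _ _
      have hconf : conf j k := by
        rcases hjk with h | h
        · exact Or.inl h
        · exact h
      rcases hone j hjQ with ho | ho
      · have hA := hi1A j hjN.1
        have hcj : cE (i1 j) j = a j := rfl
        rcases hconf with h | h | h | h
        · subst h; omega
        · subst h; exact hopen ho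
        · refine ⟨i1 j, hA, ho, ?_⟩
          have ht := htri _ hA j k
          rw [h] at hkey'
          linarith
        · refine ⟨i1 j, hA, ho, ?_⟩
          have ht := htri _ hA j (sg j)
          have ht2 := htri _ hA (sg j) k
          rw [h] at hkey' ht ht2
          rw [hsymm (sg k) k] at ht2
          linarith
      · have hA := hi1A _ hjN.2
        have hcj : cE (i1 (sg j)) (sg j) = a (sg j) := rfl
        rcases hconf with h | h | h | h
        · subst h; exact hopen ho
        · refine ⟨i1 (sg j), hA, ho, ?_⟩
          have ht := htri _ hA (sg j) j
          have ht2 := htri _ hA j k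
          rw [hsymm (sg j) j] at ht
          rw [hsymm j k] at ht2
          rw [← h] at hkey' ⊢
          linarith
        · rw [h] at ho; omega
        · rw [h] at ho; exact hopen ho
  have hall : ∀ j ∈ N, ∃ e ∈ P.A, z e = 1 ∧
      cE e j ≤ if j ∈ N1 then ∑ e ∈ B j, cE e j * z e
        else a j + 2 * cD j (sg j) - 2 * cD j (sg j) * z (i1 j) := by
    intro j hj
    by_cases h : j ∈ N1
    · obtain ⟨e, he, hze, -⟩ := hfull j h
      refine ⟨e, hBA j hj he, hze, ?_⟩
      rw [if_pos h]
      have := Finset.single_le_sum (f := fun e => cE e j * (z e : ℝ))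
        (fun e _ => mul_nonneg (hcE e j) (hz.nn e)) he
      simpa [hze] using this
    · rw [if_neg h]
      exact hhalf j ((hcase j hj).resolve_left h)
  choose! o ho1 ho2 ho3 using hall
  refine ⟨z, hz, o, fun j hj => ⟨ho1 j hj, ho2 j hj⟩, ?_⟩
  have eval : ∀ (v : E → ℝ) (k : D),
      ((if φ k ∈ N1 then 0 else a (φ k) + 2 * cD (φ k) (sg (φ k))) +
        ∑ e, (if φ k ∈ N1 then (if e ∈ B (φ k) then cE e (φ k) else 0)
      else (if e = i1 (φ k) then -(2 * cD (φ k) (sg (φ k))) else 0)) * v e)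
      = if φ k ∈ N1 then ∑ e ∈ B (φ k), cE e (φ k) * v e
        else a (φ k) + 2 * cD (φ k) (sg (φ k)) - 2 * cD (φ k) (sg (φ k)) * v (i1 (φ k)) := by
    intro v k
    by_cases h : φ k ∈ N1
    · simp [h]
    · simp [h]; ring
  simp only [eval] at hc
  have s1 : ∑ k, d k * cE (o (φ k)) (φ k) ≤ ∑ k, d k * (if φ k ∈ N1 then ∑ e ∈ B (φ k), cE e (φ k) * z e
        else a (φ k) + 2 * cD (φ k) (sg (φ k)) - 2 * cD (φ k) (sg (φ k)) * z (i1 (φ k))) :=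
    Finset.sum_le_sum fun k _ => mul_le_mul_of_nonneg_left (ho3 _ (hφ k)) (hd k)
  have s2 : ∑ k, d k * (if φ k ∈ N1 then ∑ e ∈ B (φ k), cE e (φ k) * ((Z e : ℝ) / 2)
        else a (φ k) + 2 * cD (φ k) (sg (φ k)) - 2 * cD (φ k) (sg (φ k)) * ((Z (i1 (φ k)) : ℝ) / 2)) ≤
      ∑ k, d k * tmT cE B (fun j => cD j (sg j)) (fun e => (Z e : ℝ) / 2) (φ k) := by
    refine Finset.sum_le_sum fun k _ => mul_le_mul_of_nonneg_left ?_ (hd k)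
    have hj := hφ k
    have hgen : ∀ j ∈ N, (if j ∈ N1 then ∑ e ∈ B j, cE e j * ((Z e : ℝ) / 2)
        else a j + 2 * cD j (sg j) - 2 * cD j (sg j) * ((Z (i1 j) : ℝ) / 2)) ≤
        tmT cE B (fun j => cD j (sg j)) (fun e => (Z e : ℝ) / 2) j := by
      intro j hj
      unfold tmT
      beta_reduce
      have hnn : 0 ≤ ∑ e ∈ B j, cE e j * ((Z e : ℝ) / 2) :=
        Finset.sum_nonneg fun e _ => mul_nonneg (hcE e j) (hZ.nn e)
      by_cases h : j ∈ N1
      · rw [if_pos h]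
        have h2 : ((∑ e ∈ B j, Z e : ℤ) : ℝ) = 2 := by rw [((mN1 j).1 h).2]; norm_num
        push_cast at h2
        rw [← Finset.sum_div, h2]
        linarith
      · rw [if_neg h]
        have hh := (hcase j hj).resolve_left h
        have h2 : ((∑ e ∈ B j, Z e : ℤ) : ℝ) = 1 := by rw [((mNh j).1 hh).2]; norm_num
        push_cast at h2
        rw [← Finset.sum_div, h2, hi2 j hh]
        rw [Finset.sum_eq_single_of_mem (i1 j) (hi1 j hh)
          (fun e he hne => by rw [hi3 j hh e he hne]; simp), hi2 j hh]
        have : cE (i1 j) j = a j := rfl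
        push_cast
        rw [this]
        linarith
    exact hgen _ hj
  linarith

theorem tm_centers {F1 D : Type*} [Fintype F1] [Fintype D]
    (cF : F1 → D → ℝ) (cD : D → D → ℝ)
    (hcF : ∀ i j, 0 ≤ cF i j) (hsymm : ∀ j k, cD j k = cD k j)
    (htri : ∀ i j k, cF i k ≤ cF i j + cD j k)
    (htri2 : ∀ i j k, cD j k ≤ cF i j + cF i k)
    (x : F1 → D → ℝ) (hx : ∀ i j, 0 ≤ x i j) (hx1 : ∀ j, ∑ i, x i j = 1) :
    ∃ (N : Finset D) (φ sg : D → D) (G : D → Finset F1),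
      (∀ k, φ k ∈ N) ∧
      (∀ k i, cF i k ≤ cF i (φ k) + 4 * ∑ i, cF i k * x i k) ∧
      (∀ k, ∑ i, cF i (φ k) * x i (φ k) ≤ ∑ i, cF i k * x i k) ∧
      (∀ j ∈ N, (∃ k ∈ N, k ≠ j) → sg j ∈ N ∧ sg j ≠ j) ∧
      (∀ j ∈ N, ∀ k ∈ N, j ≠ k → Disjoint (G j) (G k)) ∧
      (∀ j ∈ N, ∀ i ∈ G j, ∀ k ∈ N, k ≠ j → 2 * cF i j ≤ cD j k) ∧
      (∀ j ∈ N, 1 / 2 ≤ ∑ i ∈ G j, x i j) ∧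
      (∀ j ∈ N, ∑ i ∈ G j, x i j < 1 → ∃ k ∈ N, k ≠ j) ∧
      (∀ j ∈ N, 2 * ∑ i ∈ G j, cF i j * x i j + 2 * cD j (sg j) * (1 - ∑ i ∈ G j, x i j)
        ≤ 4 * ∑ i, cF i j * x i j) := by
  set C : D → ℝ := fun j => ∑ i, cF i j * x i j with hC
  have hC0 : ∀ j, 0 ≤ C j := fun j => Finset.sum_nonneg fun i _ => mul_nonneg (hcF i j) (hx i j)
  obtain ⟨N, -, hN1, hN2⟩ := tm_greedy C (fun j k => cD j k ≤ 4 * max (C j) (C k))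
    (by intro j k h; rw [hsymm k j, max_comm]; exact h) Finset.univ
  choose φ hφ hφC hφc using fun k => hN2 k (Finset.mem_univ k)
  have hsgex : ∀ j, ∃ s, (∃ k ∈ N, k ≠ j) → s ∈ N ∧ s ≠ j ∧ ∀ k ∈ N, k ≠ j → cD j s ≤ cD j k := by
    intro j
    by_cases h : ∃ k ∈ N, k ≠ j
    · obtain ⟨k, hk, hkj⟩ := h
      obtain ⟨s, hs, hmin⟩ := Finset.exists_min_image (N.erase j) (cD j)
        ⟨k, Finset.mem_erase.2 ⟨hkj, hk⟩⟩
      rw [Finset.mem_erase] at hs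
      exact ⟨s, fun _ => ⟨hs.2, hs.1, fun k hk hkj => hmin k (Finset.mem_erase.2 ⟨hkj, hk⟩)⟩⟩
    · exact ⟨j, fun h' => absurd h' h⟩
  choose sg hsg using hsgex
  let G : D → Finset F1 := fun j => Finset.univ.filter fun i => ∀ k ∈ N, k ≠ j → 2 * cF i j < cD j k
  have mG : ∀ j i, i ∈ G j ↔ ∀ k ∈ N, k ≠ j → 2 * cF i j < cD j k := fun j i => by simp [G]
  have hnG : ∀ j i, i ∉ G j → (∃ k ∈ N, k ≠ j) ∧ cD j (sg j) ≤ 2 * cF i j := by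
    intro j i h
    rw [mG] at h
    push Not at h
    obtain ⟨k, hk, hkj, hle⟩ := h
    have hex : ∃ k ∈ N, k ≠ j := ⟨k, hk, hkj⟩
    exact ⟨hex, ((hsg j hex).2.2 k hk hkj).trans hle⟩
  have hsplit1 : ∀ j, ∑ i ∈ G j, x i j + ∑ i ∈ (G j)ᶜ, x i j = 1 := fun j => by
    rw [Finset.sum_add_sum_compl, hx1]
  have hsplit2 : ∀ j, ∑ i ∈ G j, cF i j * x i j + ∑ i ∈ (G j)ᶜ, cF i j * x i j = C j := fun j => by
    rw [Finset.sum_add_sum_compl]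
  have hout : ∀ j, cD j (sg j) * ∑ i ∈ (G j)ᶜ, x i j ≤ 2 * ∑ i ∈ (G j)ᶜ, cF i j * x i j := by
    intro j
    rw [Finset.mul_sum, Finset.mul_sum]
    refine Finset.sum_le_sum fun i hi => ?_
    have := mul_le_mul_of_nonneg_right (hnG j i (Finset.mem_compl.1 hi)).2 (hx i j)
    linarith
  have hin : ∀ j, 0 ≤ ∑ i ∈ G j, cF i j * x i j := fun j =>
    Finset.sum_nonneg fun i _ => mul_nonneg (hcF i j) (hx i j)
  have hex : ∀ j ∈ N, ∑ i ∈ G j, x i j < 1 → ∃ k ∈ N, k ≠ j := by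
    intro j hj h
    have h1 := hsplit1 j
    have hne : ∃ i, i ∈ (G j)ᶜ := by
      by_contra hcon
      push Not at hcon
      rw [Finset.eq_empty_of_forall_notMem hcon, Finset.sum_empty] at h1
      linarith
    obtain ⟨i, hi⟩ := hne
    exact (hnG j i (Finset.mem_compl.1 hi)).1
  refine ⟨N, φ, sg, G, hφ, ?_, hφC, fun j _ h => ⟨(hsg j h).1, (hsg j h).2.1⟩, ?_, ?_, ?_, hex, ?_⟩
  · intro k i
    have h0 := hC0 k
    rcases hφc k with h | h
    · rw [h]
      linarith
    · rw [max_eq_right (hφC k)] at h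
      have := htri i (φ k) k
      linarith
  · intro j hj k hk hjk
    rw [Finset.disjoint_left]
    intro i h1 h2
    have h1 := (mG j i).1 h1 k hk hjk.symm
    have h2 := (mG k i).1 h2 j hj hjk
    have := htri2 i j k
    rw [hsymm k j] at h2
    linarith
  · intro j _ i hi k hk hkj
    exact ((mG j i).1 hi k hk hkj).le
  · intro j hj
    by_contra hlt
    push Not at hlt
    have h1 := hsplit1 j
    have h2 := hsplit2 j
    have h3 := hout j
    have h4 := hin j
    have h5 := hsg j (hex j hj (by linarith))
    have h6 := hN1 j hj _ h5.1 h5.2.1.symm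
    push Not at h6
    have h7 := le_max_left (C j) (C (sg j))
    have h8 := hC0 j
    nlinarith
  · intro j hj
    have h1 := hsplit1 j
    have h2 := hsplit2 j
    have h3 := hout j
    have h4 := hin j
    have h5 : 1 - ∑ i ∈ G j, x i j = ∑ i ∈ (G j)ᶜ, x i j := by linarith
    have h6 : (∑ i, cF i j * x i j) = C j := rfl
    rw [h5]
    linarith

/-- The projection from split facilities to facilities. -/
def tmPi {F1 F2 : Type*} : (F1 × Bool) ⊕ F2 → F1 ⊕ F2 := Sum.map Prod.fst id

set_option maxHeartbeats 1000000 in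
theorem tm_norm
    {F1 F2 D : Type*} [Fintype F1] [Fintype F2] [Fintype D]
    (c : F1 ⊕ D → F1 ⊕ D → ℝ)
    (hc_nonneg : ∀ u v, 0 ≤ c u v)
    (hc_symm : ∀ u v, c u v = c v u)
    (hc_tri : ∀ u v w, c u w ≤ c u v + c v w)
    (f : F1 ⊕ F2 → ℝ)
    (d : D → ℝ) (hd : ∀ j, 0 ≤ d j)
    (M : Matroid (F1 ⊕ F2)) (M2 : Matroid F2)
    (lb1 ub1 lb2 ub2 lb ub : ℤ)
    (x : F1 → D → ℝ) (y : F1 ⊕ F2 → ℝ)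
    (hx : ∀ i j, 0 ≤ x i j) (hy : ∀ i, 0 ≤ y i)
    (hx1 : ∀ j, ∑ i, x i j = 1)
    (hxy : ∀ i j, x i j ≤ y (Sum.inl i))
    (hrank : ∀ S : Finset (F1 ⊕ F2), ∑ i ∈ S, y i ≤ (matroidRank M S : ℝ))
    (hrank2 : ∀ S : Finset F2, ∑ i ∈ S, y (Sum.inr i) ≤ (matroidRank M2 S : ℝ))
    (hlb1 : (lb1 : ℝ) ≤ ∑ i : F1, y (Sum.inl i))
    (hub1 : ∑ i : F1, y (Sum.inl i) ≤ (ub1 : ℝ))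
    (hlb2 : (lb2 : ℝ) ≤ ∑ i : F2, y (Sum.inr i))
    (hub2 : ∑ i : F2, y (Sum.inr i) ≤ (ub2 : ℝ))
    (hlb : (lb : ℝ) ≤ ∑ i, y i) (hub : ∑ i, y i ≤ (ub : ℝ)) :
    ∃ (Fs : Finset (F1 ⊕ F2)) (σ : D → F1),
      M.Indep ↑Fs ∧
      M2.Indep {i : F2 | Sum.inr i ∈ Fs} ∧
      lb1 ≤ ((Fs.filter (fun i => i.isLeft)).card : ℤ) ∧
      ((Fs.filter (fun i => i.isLeft)).card : ℤ) ≤ ub1 ∧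
      lb2 ≤ ((Fs.filter (fun i => i.isRight)).card : ℤ) ∧
      ((Fs.filter (fun i => i.isRight)).card : ℤ) ≤ ub2 ∧
      lb ≤ (Fs.card : ℤ) ∧ (Fs.card : ℤ) ≤ ub ∧
      (∀ j, Sum.inl (σ j) ∈ Fs) ∧
      (∑ i ∈ Fs, f i) + ∑ j, d j * c (Sum.inl (σ j)) (Sum.inr j) ≤
        (∑ i, f i * y i) +
          8 * ∑ j, d j * ∑ i : F1, c (Sum.inl i) (Sum.inr j) * x i j := by
  letI i1 : DecidableEq ((F1 × Bool) ⊕ F2) := fun a b => Classical.propDecidable (a = b)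
  letI i2 : DecidableEq (F1 ⊕ F2) := fun a b => Classical.propDecidable (a = b)
  obtain ⟨N, φ, sg, G, hφ, hmove, hφC, hsg, hGd, hGball, hGhalf, hGout, hGT⟩ :=
    tm_centers (fun i j => c (.inl i) (.inr j)) (fun j k => c (.inr j) (.inr k))
      (fun i j => hc_nonneg _ _) (fun j k => hc_symm _ _) (fun i j k => hc_tri _ _ _)
      (fun i j k => by rw [hc_symm (.inl i) (.inr j)]; exact hc_tri _ _ _) x hx hx1
  let w : F1 → ℝ := fun i => ∑ j ∈ N, if i ∈ G j then x i j else 0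
  have hwG : ∀ j ∈ N, ∀ i ∈ G j, w i = x i j := by
    intro j hj i hi
    simp only [w]
    rw [Finset.sum_eq_single_of_mem j hj, if_pos hi]
    intro k hk hkj
    rw [if_neg]
    intro hik
    exact Finset.disjoint_left.1 (hGd k hk j hj hkj) hik hi
  have hw0 : ∀ i, 0 ≤ w i := fun i => Finset.sum_nonneg fun j _ => by
    split_ifs
    · exact hx i j
    · exact le_rfl
  have hwy : ∀ i, w i ≤ y (.inl i) := by
    intro i
    by_cases h : ∃ j ∈ N, i ∈ G j
    · obtain ⟨j, hj, hi⟩ := h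
      rw [hwG j hj i hi]
      exact hxy i j
    · push Not at h
      have : w i = 0 := Finset.sum_eq_zero fun j hj => if_neg (h j hj)
      rw [this]
      exact hy _
  let y' : (F1 × Bool) ⊕ F2 → ℝ :=
    Sum.elim (fun p => if p.2 then w p.1 else y (.inl p.1) - w p.1) (fun i => y (.inr i))
  have hy'0 : ∀ e, 0 ≤ y' e := by
    rintro (⟨i, b⟩ | i)
    · simp only [y', Sum.elim_inl]
      split_ifs
      · exact hw0 i
      · linarith [hwy i]
    · exact hy _
  have hpush : ∀ h : F1 ⊕ F2 → ℝ, ∑ e, h (tmPi e) * y' e = ∑ b, h b * y b := by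
    intro h
    rw [Fintype.sum_sum_type, Fintype.sum_sum_type, Fintype.sum_prod_type]
    congr 1
    apply Finset.sum_congr rfl
    intro i _
    rw [Fintype.sum_bool]
    simp [y', tmPi]
    ring
  let A : Finset ((F1 × Bool) ⊕ F2) := Finset.univ.filter fun e => e.isLeft
  let P : TMSys ((F1 × Bool) ⊕ F2) :=
    { A := A
      r1 := fun S => (matroidRank M (S.image tmPi) : ℤ)
      r2 := fun S => (matroidRank M2 (Finset.univ.filter fun i => Sum.inr i ∈ S) : ℤ)
      l1 := lb1
      u1 := ub1
      l2 := lb2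
      u2 := ub2
      l := lb
      u := ub }
  have hsumA : ∀ g : (F1 × Bool) ⊕ F2 → ℝ,
      ∑ e ∈ A, g e = ∑ e, (if (tmPi e).isLeft then (1 : ℝ) else 0) * g e := by
    intro g
    simp only [A, Finset.sum_filter]
    apply Finset.sum_congr rfl
    rintro (e | e) _ <;> simp [tmPi]
  have hsumA' : ∀ g : (F1 × Bool) ⊕ F2 → ℝ,
      ∑ e ∈ Aᶜ, g e = ∑ e, (if (tmPi e).isRight then (1 : ℝ) else 0) * g e := by
    intro g
    have : Aᶜ = Finset.univ.filter fun e : (F1 × Bool) ⊕ F2 => e.isRight := by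
      ext e
      rcases e with e | e <;> simp [A]
    rw [this, Finset.sum_filter]
    apply Finset.sum_congr rfl
    rintro (e | e) _ <;> simp [tmPi]
  have hsum1 : ∀ g : (F1 × Bool) ⊕ F2 → ℝ, ∑ e, g e = ∑ e, (fun _ => (1 : ℝ)) (tmPi e) * g e := by
    intro g
    simp
  have hsumR : ∀ (S : Finset ((F1 × Bool) ⊕ F2)) (g : (F1 × Bool) ⊕ F2 → ℝ),
      ∑ e ∈ S \ A, g e = ∑ i ∈ Finset.univ.filter (fun i => Sum.inr i ∈ S \ A), g (.inr i) := by
    intro S g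
    rw [Finset.sum_filter, ← Finset.univ_inter (S \ A), ← Finset.sum_ite_mem, Fintype.sum_sum_type]
    simp [A]
  have hbL : ∑ b : F1 ⊕ F2, (if b.isLeft then (1 : ℝ) else 0) * y b = ∑ i, y (.inl i) := by
    rw [Fintype.sum_sum_type]; simp
  have hbR : ∑ b : F1 ⊕ F2, (if b.isRight then (1 : ℝ) else 0) * y b = ∑ i, y (.inr i) := by
    rw [Fintype.sum_sum_type]; simp
  have e1 : ∑ e ∈ A, y' e = ∑ i, y (.inl i) := by
    rw [hsumA, ← hbL]
    exact hpush fun b => if b.isLeft then (1 : ℝ) else 0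
  have e2 : ∑ e ∈ Aᶜ, y' e = ∑ i, y (.inr i) := by
    rw [hsumA', ← hbR]
    exact hpush fun b => if b.isRight then (1 : ℝ) else 0
  have e3 : ∑ e, y' e = ∑ b, y b := by
    have h := hpush fun _ => (1 : ℝ)
    simpa using h
  have hFeas : P.Feas y' :=
    { nn := hy'0
      h1 := by
        intro S
        have h := hpush fun b => if b ∈ S.image tmPi then 1 else 0
        have h2 : ∑ b, (if b ∈ S.image tmPi then (1 : ℝ) else 0) * y b = ∑ b ∈ S.image tmPi, y b := by
          simp only [ite_mul, one_mul, zero_mul, Finset.sum_ite_mem, Finset.univ_inter]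
        have h3 : ∑ e ∈ S, y' e ≤ ∑ e, (if tmPi e ∈ S.image tmPi then (1 : ℝ) else 0) * y' e := by
          rw [← Finset.univ_inter S, ← Finset.sum_ite_mem]
          refine Finset.sum_le_sum fun e _ => ?_
          by_cases he : e ∈ S
          · rw [if_pos he, Finset.univ_inter, if_pos (Finset.mem_image_of_mem _ he), one_mul]
          · rw [if_neg he]
            refine mul_nonneg ?_ (hy'0 e)
            split_ifs <;> norm_num
        have h4 := hrank (S.image tmPi)
        have h5 : ((P.r1 S : ℤ) : ℝ) = (matroidRank M (S.image tmPi) : ℝ) := by simp [P]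
        rw [h5]
        linarith
      h2 := by
        intro S
        have h5 : ((P.r2 (S \ P.A) : ℤ) : ℝ) =
          (matroidRank M2 (Finset.univ.filter fun i => Sum.inr i ∈ S \ A) : ℝ) := by simp [P]
        rw [h5]
        have h6 := hsumR S y'
        change ∑ e ∈ S \ A, y' e ≤ _
        rw [h6]
        exact hrank2 _
      b1l := by change (lb1 : ℝ) ≤ ∑ e ∈ A, y' e; rw [e1]; exact hlb1
      b1u := by change ∑ e ∈ A, y' e ≤ (ub1 : ℝ); rw [e1]; exact hub1
      b2l := by change (lb2 : ℝ) ≤ ∑ e ∈ Aᶜ, y' e; rw [e2]; exact hlb2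
      b2u := by change ∑ e ∈ Aᶜ, y' e ≤ (ub2 : ℝ); rw [e2]; exact hub2
      bl := by change (lb : ℝ) ≤ ∑ e, y' e; rw [e3]; exact hlb
      bu := by change ∑ e, y' e ≤ (ub : ℝ); rw [e3]; exact hub }
  have hsub1 : ∀ S T, P.r1 (S ∩ T) + P.r1 (S ∪ T) ≤ P.r1 S + P.r1 T := by
    intro S T
    have h1 := tm_rank_submod M (S.image tmPi) (T.image tmPi)
    have h2 := tm_rank_mono M (Finset.image_inter_subset tmPi S T)
    rw [← Finset.image_union] at h1
    have : matroidRank M ((S ∩ T).image tmPi) + matroidRank M ((S ∪ T).image tmPi) ≤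
      matroidRank M (S.image tmPi) + matroidRank M (T.image tmPi) := by omega
    simp only [P]
    exact_mod_cast this
  have hsub2 : ∀ S T, P.r2 (S ∩ T) + P.r2 (S ∪ T) ≤ P.r2 S + P.r2 T := by
    intro S T
    have h1 := tm_rank_submod M2 (Finset.univ.filter fun i => Sum.inr i ∈ S)
      (Finset.univ.filter fun i => Sum.inr i ∈ T)
    have h2 : (Finset.univ.filter fun i : F2 => (Sum.inr i : (F1 × Bool) ⊕ F2) ∈ S) ∩
      (Finset.univ.filter fun i => Sum.inr i ∈ T) = Finset.univ.filter fun i => Sum.inr i ∈ S ∩ T := by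
      ext i; simp
    have h3 : (Finset.univ.filter fun i : F2 => (Sum.inr i : (F1 × Bool) ⊕ F2) ∈ S) ∪
      (Finset.univ.filter fun i => Sum.inr i ∈ T) = Finset.univ.filter fun i => Sum.inr i ∈ S ∪ T := by
      ext i; simp
    rw [h2, h3] at h1
    simp only [P]
    exact_mod_cast h1
  have hr1 : ∀ e, P.r1 {e} ≤ 1 := by
    intro e
    have := tm_rank_le_card M (({e} : Finset ((F1 × Bool) ⊕ F2)).image tmPi)
    rw [Finset.image_singleton, Finset.card_singleton] at this
    simp only [P, Finset.image_singleton]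
    exact_mod_cast this
  let cE : (F1 × Bool) ⊕ F2 → D → ℝ :=
    fun e j => Sum.elim (fun p : F1 × Bool => c (.inl p.1) (.inr j)) (fun _ => 0) e
  have hcE : ∀ e j, 0 ≤ cE e j := by
    rintro (e | e) j
    · exact hc_nonneg _ _
    · exact le_rfl
  have hinj : Function.Injective fun i : F1 => (Sum.inl (i, true) : (F1 × Bool) ⊕ F2) := by
    intro i i' h
    simpa using h
  let B : D → Finset ((F1 × Bool) ⊕ F2) := fun j => (G j).map ⟨fun i => Sum.inl (i, true), hinj⟩
  have hBA : ∀ j ∈ N, B j ⊆ P.A := by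
    intro j _ e he
    simp only [B, Finset.mem_map, Function.Embedding.coeFn_mk] at he
    obtain ⟨i, _, rfl⟩ := he
    simp [P, A]
  have hBd : ∀ j ∈ N, ∀ k ∈ N, j ≠ k → Disjoint (B j) (B k) := fun j hj k hk hjk =>
    (Finset.disjoint_map _).2 (hGd j hj k hk hjk)
  have hBsum : ∀ j ∈ N, ∑ e ∈ B j, y' e = ∑ i ∈ G j, x i j := by
    intro j hj
    simp only [B, Finset.sum_map, Function.Embedding.coeFn_mk]
    refine Finset.sum_congr rfl fun i hi => ?_
    rw [← hwG j hj i hi]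
    simp [y']
  have hBsumc : ∀ j ∈ N, ∑ e ∈ B j, cE e j * y' e = ∑ i ∈ G j, c (.inl i) (.inr j) * x i j := by
    intro j hj
    simp only [B, Finset.sum_map, Function.Embedding.coeFn_mk]
    refine Finset.sum_congr rfl fun i hi => ?_
    rw [← hwG j hj i hi]
    simp [y', cE]
  have hGle : ∀ j ∈ N, ∑ i ∈ G j, x i j ≤ 1 := fun j _ => by
    rw [← hx1 j]
    exact Finset.sum_le_sum_of_subset_of_nonneg (Finset.subset_univ _) fun i _ _ => hx i j
  obtain ⟨Z, hZ, hZB, hZc⟩ := tm_half P hsub1 hsub2 cE (fun j => c (.inr j) (.inr (sg j))) N B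
    hBA hBd (fun e => f (tmPi e)) d φ y' hFeas
    (fun j hj => by rw [hBsum j hj]; exact hGhalf j hj)
    (fun j hj => by rw [hBsum j hj]; exact hGle j hj)
    (fun j hj => by rw [hBsum j hj]; exact hGout j hj)
  obtain ⟨z, hz, o, ho, hzc⟩ := tm_int P hsub1 hsub2 hr1 cE (fun j k => c (.inr j) (.inr k)) N B
    hcE (fun _ _ => hc_nonneg _ _) (fun _ _ => hc_symm _ _)
    (by
      rintro (e | e) he j k
      · exact hc_tri _ _ _
      · simp [P, A] at he)
    hBA hBd
    (by
      intro j hj e he k hk hkj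
      simp only [B, Finset.mem_map, Function.Embedding.coeFn_mk] at he
      obtain ⟨i, hi, rfl⟩ := he
      exact hGball j hj i hi k hk hkj)
    sg hsg (fun e => f (tmPi e)) d hd φ hφ Z hZ hZB
  -- the support
  have hz0 : ∀ e, 0 ≤ z e := fun e => by
    have := hz.nn e
    exact_mod_cast this
  have hz1 : ∀ e, z e ≤ 1 := fun e => by
    have := hz.h1 {e}
    rw [Finset.sum_singleton] at this
    have h2 : z e ≤ P.r1 {e} := by exact_mod_cast this
    exact h2.trans (hr1 e)
  let S : Finset ((F1 × Bool) ⊕ F2) := Finset.univ.filter fun e => z e = 1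
  have mS : ∀ e, e ∈ S ↔ z e = 1 := fun e => by simp [S]
  have hzS : ∀ e, (z e : ℝ) = if e ∈ S then 1 else 0 := by
    intro e
    have h0 := hz0 e
    have h1 := hz1 e
    by_cases h : e ∈ S
    · rw [if_pos h, (mS e).1 h]; norm_num
    · rw [if_neg h]
      rw [mS] at h
      have : z e = 0 := by omega
      rw [this]; norm_num
  have hSle : #S ≤ matroidRank M (S.image tmPi) := by
    have h := hz.h1 S
    have h2 : ∑ e ∈ S, (z e : ℝ) = (#S : ℝ) := by
      rw [Finset.sum_congr rfl fun e he => show (z e : ℝ) = 1 by rw [hzS e, if_pos he]]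
      simp
    rw [h2] at h
    simp only [P] at h
    exact_mod_cast h
  have hcard : #(S.image tmPi) = #S := le_antisymm Finset.card_image_le
    (hSle.trans (tm_rank_le_card M _))
  have hinjS : Set.InjOn tmPi (S : Set ((F1 × Bool) ⊕ F2)) := Finset.card_image_iff.1 hcard
  have hsum : ∀ h : F1 ⊕ F2 → ℝ, ∑ b ∈ S.image tmPi, h b = ∑ e, h (tmPi e) * (z e : ℝ) := by
    intro h
    rw [Finset.sum_image hinjS]
    simp only [hzS, mul_ite, mul_one, mul_zero, Finset.sum_ite_mem, Finset.univ_inter]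
  have hcL : ((#((S.image tmPi).filter fun b => b.isLeft) : ℤ) : ℝ) = ∑ e ∈ A, (z e : ℝ) := by
    rw [hsumA]
    have := hsum fun b => if b.isLeft then (1 : ℝ) else 0
    rw [← this, ← Finset.sum_filter]
    simp
  have hcR : ((#((S.image tmPi).filter fun b => b.isRight) : ℤ) : ℝ) = ∑ e ∈ Aᶜ, (z e : ℝ) := by
    rw [hsumA']
    have := hsum fun b => if b.isRight then (1 : ℝ) else 0
    rw [← this, ← Finset.sum_filter]
    simp
  have hcT : ((#(S.image tmPi) : ℤ) : ℝ) = ∑ e, (z e : ℝ) := by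
    have := hsum fun _ => (1 : ℝ)
    rw [hsum1, ← this]
    simp
  have hσ : ∀ k, ∃ i b, o (φ k) = Sum.inl (i, b) := by
    intro k
    have h := (ho _ (hφ k)).1
    rcases ho' : o (φ k) with ⟨i, b⟩ | i
    · exact ⟨i, b, rfl⟩
    · rw [ho'] at h
      simp [P, A] at h
  choose σ bb hσ using hσ
  refine ⟨S.image tmPi, σ, ?_, ?_, ?_, ?_, ?_, ?_, ?_, ?_, ?_, ?_⟩
  · exact tm_indep_of_rank M _ (by rw [hcard]; exact hSle)
  · have hset : {i : F2 | Sum.inr i ∈ S.image tmPi} =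
        ↑(Finset.univ.filter fun i : F2 => (Sum.inr i : (F1 × Bool) ⊕ F2) ∈ S \ A) := by
      ext i
      simp only [Set.mem_setOf_eq, Finset.mem_image, Finset.coe_filter, Finset.mem_univ, true_and,
        Finset.mem_sdiff]
      constructor
      · rintro ⟨e, he, hei⟩
        rcases e with e | e
        · simp [tmPi] at hei
        · simp only [tmPi, Sum.map_inr, id, Sum.inr.injEq] at hei
          subst hei
          exact ⟨he, by simp [A]⟩
      · intro h
        exact ⟨.inr i, h.1, rfl⟩
    rw [hset]
    apply tm_indep_of_rank
    have h := hz.h2 S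
    have h6 := hsumR S fun e => (z e : ℝ)
    change ∑ e ∈ S \ A, (z e : ℝ) ≤ _ at h
    rw [h6] at h
    rw [Finset.sum_congr rfl (g := fun _ => (1 : ℝ)) fun i hi => by
      rw [hzS, if_pos (Finset.mem_sdiff.1 (Finset.mem_filter.1 hi).2).1]] at h
    rw [Finset.sum_const, nsmul_eq_mul, mul_one] at h
    simp only [P] at h
    exact_mod_cast h
  · have := hz.b1l
    have h : ((lb1 : ℤ) : ℝ) ≤ ((#((S.image tmPi).filter fun b => b.isLeft) : ℤ) : ℝ) := by
      rw [hcL]; exact this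
    exact_mod_cast h
  · have := hz.b1u
    have h : ((#((S.image tmPi).filter fun b => b.isLeft) : ℤ) : ℝ) ≤ ((ub1 : ℤ) : ℝ) := by
      rw [hcL]; exact this
    exact_mod_cast h
  · have := hz.b2l
    have h : ((lb2 : ℤ) : ℝ) ≤ ((#((S.image tmPi).filter fun b => b.isRight) : ℤ) : ℝ) := by
      rw [hcR]; exact this
    exact_mod_cast h
  · have := hz.b2u
    have h : ((#((S.image tmPi).filter fun b => b.isRight) : ℤ) : ℝ) ≤ ((ub2 : ℤ) : ℝ) := by
      rw [hcR]; exact this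
    exact_mod_cast h
  · have := hz.bl
    have h : ((lb : ℤ) : ℝ) ≤ ((#(S.image tmPi) : ℤ) : ℝ) := by
      rw [hcT]; exact this
    exact_mod_cast h
  · have := hz.bu
    have h : ((#(S.image tmPi) : ℤ) : ℝ) ≤ ((ub : ℤ) : ℝ) := by
      rw [hcT]; exact this
    exact_mod_cast h
  · intro k
    have h := (ho _ (hφ k)).2
    rw [hσ k, ← mS] at h
    exact Finset.mem_image.2 ⟨_, h, rfl⟩
  · rw [hsum]
    have t1 : ∑ k, d k * c (.inl (σ k)) (.inr k) ≤ ∑ k, d k * cE (o (φ k)) (φ k) +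
        4 * ∑ k, d k * ∑ i : F1, c (.inl i) (.inr k) * x i k := by
      rw [Finset.mul_sum, ← Finset.sum_add_distrib]
      refine Finset.sum_le_sum fun k _ => ?_
      have h1 := hmove k (σ k)
      have h2 : cE (o (φ k)) (φ k) = c (.inl (σ k)) (.inr (φ k)) := by rw [hσ k]; rfl
      rw [h2]
      have := mul_le_mul_of_nonneg_left h1 (hd k)
      linarith
    have t2 : ∑ k, d k * tmT cE B (fun j => c (.inr j) (.inr (sg j))) y' (φ k) ≤
        4 * ∑ k, d k * ∑ i : F1, c (.inl i) (.inr k) * x i k := by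
      rw [Finset.mul_sum]
      refine Finset.sum_le_sum fun k _ => ?_
      have h1 := hGT (φ k) (hφ k)
      have h2 := hφC k
      have h3 : tmT cE B (fun j => c (.inr j) (.inr (sg j))) y' (φ k) ≤
          4 * ∑ i : F1, c (.inl i) (.inr k) * x i k := by
        unfold tmT
        rw [hBsum _ (hφ k), hBsumc _ (hφ k)]
        linarith
      have := mul_le_mul_of_nonneg_left h3 (hd k)
      linarith
    have t3 := hpush f
    linarith

/-- Theorem 4.4: any fractional solution to the two-matroid median problem can
be rounded to an integral solution of cost at most 8 times larger. -/
theorem two_matroid_median_8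
    {F1 F2 D : Type*} [Fintype F1] [Fintype F2] [Fintype D]
    (c : F1 ⊕ D → F1 ⊕ D → ℝ)
    (hc_nonneg : ∀ u v, 0 ≤ c u v)
    (hc_symm : ∀ u v, c u v = c v u)
    (hc_tri : ∀ u v w, c u w ≤ c u v + c v w)
    (f : F1 ⊕ F2 → ℝ) (hf : ∀ i, 0 ≤ f i)
    (d : D → ℝ) (hd : ∀ j, 0 ≤ d j)
    (M : Matroid (F1 ⊕ F2)) (hME : M.E = Set.univ)
    (M2 : Matroid F2) (hM2E : M2.E = Set.univ)
    (lb1 ub1 lb2 ub2 lb ub : ℤ)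
    (hb1 : lb1 ≤ ub1) (hb2 : lb2 ≤ ub2) (hb : lb ≤ ub)
    (x : F1 → D → ℝ) (y : F1 ⊕ F2 → ℝ)
    (hx : ∀ i j, 0 ≤ x i j) (hy : ∀ i, 0 ≤ y i)
    (hx1 : ∀ j, 1 ≤ ∑ i, x i j)
    (hxy : ∀ i j, x i j ≤ y (Sum.inl i))
    (hrank : ∀ S : Finset (F1 ⊕ F2), ∑ i ∈ S, y i ≤ (matroidRank M S : ℝ))
    (hrank2 : ∀ S : Finset F2, ∑ i ∈ S, y (Sum.inr i) ≤ (matroidRank M2 S : ℝ))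
    (hlb1 : (lb1 : ℝ) ≤ ∑ i : F1, y (Sum.inl i))
    (hub1 : ∑ i : F1, y (Sum.inl i) ≤ (ub1 : ℝ))
    (hlb2 : (lb2 : ℝ) ≤ ∑ i : F2, y (Sum.inr i))
    (hub2 : ∑ i : F2, y (Sum.inr i) ≤ (ub2 : ℝ))
    (hlb : (lb : ℝ) ≤ ∑ i, y i) (hub : ∑ i, y i ≤ (ub : ℝ)) :
    ∃ (Fs : Finset (F1 ⊕ F2)) (σ : D → F1),
      M.Indep ↑Fs ∧
      M2.Indep {i : F2 | Sum.inr i ∈ Fs} ∧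
      lb1 ≤ ((Fs.filter (fun i => i.isLeft)).card : ℤ) ∧
      ((Fs.filter (fun i => i.isLeft)).card : ℤ) ≤ ub1 ∧
      lb2 ≤ ((Fs.filter (fun i => i.isRight)).card : ℤ) ∧
      ((Fs.filter (fun i => i.isRight)).card : ℤ) ≤ ub2 ∧
      lb ≤ (Fs.card : ℤ) ∧ (Fs.card : ℤ) ≤ ub ∧
      (∀ j, Sum.inl (σ j) ∈ Fs) ∧
      (∑ i ∈ Fs, f i) + ∑ j, d j * c (Sum.inl (σ j)) (Sum.inr j) ≤
        8 * ((∑ i, f i * y i) +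
          ∑ j, ∑ i : F1, d j * c (Sum.inl i) (Sum.inr j) * x i j) := by
  classical
  have hs : ∀ j, 0 < ∑ i, x i j := fun j => lt_of_lt_of_le one_pos (hx1 j)
  have hle : ∀ i j, x i j / ∑ i, x i j ≤ x i j := fun i j => div_le_self (hx i j) (hx1 j)
  obtain ⟨Fs, σ, h1, h2, h3, h4, h5, h6, h7, h8, h9, h10⟩ := tm_norm c hc_nonneg hc_symm hc_tri f d hd
    M M2 lb1 ub1 lb2 ub2 lb ub (fun i j => x i j / ∑ i, x i j) y
    (fun i j => div_nonneg (hx i j) (hs j).le) hy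
    (fun j => by rw [← Finset.sum_div]; exact div_self (hs j).ne')
    (fun i j => (hle i j).trans (hxy i j)) hrank hrank2 hlb1 hub1 hlb2 hub2 hlb hub
  refine ⟨Fs, σ, h1, h2, h3, h4, h5, h6, h7, h8, h9, h10.trans ?_⟩
  have t1 : 0 ≤ ∑ i, f i * y i := Finset.sum_nonneg fun i _ => mul_nonneg (hf i) (hy i)
  have t2 : ∑ j, d j * ∑ i : F1, c (Sum.inl i) (Sum.inr j) * (x i j / ∑ i, x i j) ≤
      ∑ j, ∑ i : F1, d j * c (Sum.inl i) (Sum.inr j) * x i j := by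
    refine Finset.sum_le_sum fun j _ => ?_
    rw [Finset.mul_sum]
    refine Finset.sum_le_sum fun i _ => ?_
    rw [← mul_assoc]
    exact mul_le_mul_of_nonneg_left (hle i j) (mul_nonneg (hd j) (hc_nonneg _ _))
  linarith
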